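/- (Global comparison principle under normal controllability.) Let u : S → ℝ be a bounded upper semicontinuous viscosity subsolution of the Hamilton–Jacobi equation λu(x) + sup_{(ζ,ξ)∈FL(x)}{−Du(x,ζ) − ξ} = 0 in S, and let v : S → ℝ be a bounded lower semicontinuous viscosity supersolution of the same equation. Then u ≤ v in S. -/

import Mathlib

open scoped RealInnerProductSpace
open Set Metric MeasureTheory

noncomputable section

abbrev E3 : Type := EuclideanSpace ℝ (Fin 3)

/-- The closed half-plane `ℝ e0 × ℝ₊ ei`. -/
def halfPlane (e0 ei : E3) : Set E3 :=
  {x | ∃ x0 xi : ℝ, 0 ≤ xi ∧ x = x0 • e0 + xi • ei}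

/-- The interface `Γ = ℝ e0`. -/
def iface (e0 : E3) : Set E3 := {x | ∃ t : ℝ, x = t • e0}

/-- The junction `S = ⋃ i Pᵢ`. -/
def junction (N : ℕ) (e0 : E3) (e : Fin N → E3) : Set E3 :=
  ⋃ i, halfPlane e0 (e i)

/-- Admissible test functions on the junction: continuous on `S`, `C¹` on each
half-plane `Pᵢ`, with `Dφ i x ∈ ℝ e0 + ℝ eᵢ` the gradient of `φ|_{Pᵢ}`. -/
structure TestFun (N : ℕ) (e0 : E3) (e : Fin N → E3) where
  φ : E3 → ℝ
  Dφ : Fin N → E3 → E3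
  cont : ContinuousOn φ (junction N e0 e)
  dphi_plane : ∀ i, ∀ x ∈ halfPlane e0 (e i), ∃ c0 ci : ℝ, Dφ i x = c0 • e0 + ci • e i
  hasDeriv : ∀ i, ∀ x ∈ halfPlane e0 (e i),
    HasFDerivWithinAt φ (innerSL ℝ (Dφ i x)) (halfPlane e0 (e i)) x
  contDeriv : ∀ i, ContinuousOn (Dφ i) (halfPlane e0 (e i))

/-- Viscosity subsolution of `λ u(x) + sup_{(ζ,ξ) ∈ FL(x)} {-Du(x,ζ) - ξ} = 0` on `S`,
where `FL(x) = FLᵢ(x)` if `x ∈ Pᵢ \ Γ` and `FL(x) = ⋃ᵢ FLᵢ⁺(x)` if `x ∈ Γ`. -/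
def IsSubSol (N : ℕ) (e0 : E3) (e : Fin N → E3) {A : Type} [MetricSpace A]
    (Ai : Fin N → Set A) (f : Fin N → E3 → A → E3) (ℓ : Fin N → E3 → A → ℝ)
    (lam : ℝ) (u : E3 → ℝ) : Prop :=
  ∀ x ∈ junction N e0 e, ∀ ψ : TestFun N e0 e,
    IsLocalMaxOn (fun y => u y - ψ.φ y) (junction N e0 e) x →
    ∀ i, x ∈ halfPlane e0 (e i) → ∀ a ∈ Ai i,
      (x ∉ iface e0 ∨ 0 ≤ ⟪f i x a, e i⟫) →
      lam * u x - ⟪ψ.Dφ i x, f i x a⟫ - ℓ i x a ≤ 0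

/-- Viscosity supersolution of the same Hamilton-Jacobi equation on `S`. -/
def IsSuperSol (N : ℕ) (e0 : E3) (e : Fin N → E3) {A : Type} [MetricSpace A]
    (Ai : Fin N → Set A) (f : Fin N → E3 → A → E3) (ℓ : Fin N → E3 → A → ℝ)
    (lam : ℝ) (v : E3 → ℝ) : Prop :=
  ∀ x ∈ junction N e0 e, ∀ ψ : TestFun N e0 e,
    IsLocalMinOn (fun y => v y - ψ.φ y) (junction N e0 e) x →
    ∃ i, x ∈ halfPlane e0 (e i) ∧ ∃ a ∈ Ai i,
      (x ∉ iface e0 ∨ 0 ≤ ⟪f i x a, e i⟫) ∧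
      0 ≤ lam * v x - ⟪ψ.Dφ i x, f i x a⟫ - ℓ i x a

namespace JunctionHJ

open Filter Topology

/-- Maximizers of `Φ - n g` on a compact set, for `n` large, are close to the maximizers of `Φ` on
`{g = 0}`, and the penalty `n g` is small there. -/
theorem exists_maximizer_penalized {X : Type*} [TopologicalSpace X] {s : Set X}
    (hs : IsCompact s) {Φ g d : X → ℝ} (hΦ : UpperSemicontinuous Φ) (hg : Continuous g)
    (hd : Continuous d) (hg0 : ∀ x, 0 ≤ g x) (hd0 : ∀ x, 0 ≤ d x) {x₀ : X} (hx₀ : x₀ ∈ s)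
    (hgx₀ : g x₀ = 0) (hmax : ∀ x ∈ s, g x = 0 → Φ x + d x ≤ Φ x₀) {ε : ℝ} (hε : 0 < ε) :
    ∃ n : ℝ, 1 ≤ n ∧ ∃ w ∈ s, (∀ x ∈ s, Φ x - n * g x ≤ Φ w - n * g w) ∧
      n * g w < ε ∧ d w < ε := by
  have hΦd : UpperSemicontinuous fun x => Φ x + d x := hΦ.add hd.upperSemicontinuous
  obtain ⟨xm, -, hxm⟩ := (hΦ.upperSemicontinuousOn s).exists_isMaxOn ⟨x₀, hx₀⟩ hs
  have hbd : ∀ x ∈ s, Φ x ≤ Φ xm := fun x hx => hxm hx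
  have hcpt : IsCompact (s ∩ (fun x => Φ x + d x) ⁻¹' Ici (Φ x₀ + ε)) :=
    hs.inter_right (hΦd.isClosed_preimage _)
  obtain ⟨n, hn1, hn⟩ : ∃ n : ℝ, 1 ≤ n ∧ ∀ x ∈ s, Φ x₀ + ε ≤ Φ x + d x →
      Φ x < Φ x₀ + n * g x := by
    rcases (s ∩ (fun x => Φ x + d x) ⁻¹' Ici (Φ x₀ + ε)).eq_empty_or_nonempty with he | hne
    · exact ⟨1, le_rfl, fun x hx h => (eq_empty_iff_forall_notMem.1 he x ⟨hx, h⟩).elim⟩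
    · obtain ⟨y, hy, hymin⟩ := hcpt.exists_isMinOn hne hg.continuousOn
      have hgy : 0 < g y := by
        rcases (hg0 y).lt_or_eq with h | h
        · exact h
        · have h1 := hmax y hy.1 h.symm
          have h2 : Φ x₀ + ε ≤ Φ y + d y := hy.2
          linarith
      refine ⟨max 1 ((Φ xm - Φ x₀ + 1) / g y), le_max_left _ _, fun x hx h => ?_⟩
      have h1 : g y ≤ g x := hymin ⟨hx, h⟩
      have h2 : Φ xm - Φ x₀ + 1 ≤ max 1 ((Φ xm - Φ x₀ + 1) / g y) * g y := by
        rw [← div_le_iff₀ hgy]; exact le_max_right _ _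
      have h3 : max 1 ((Φ xm - Φ x₀ + 1) / g y) * g y ≤
          max 1 ((Φ xm - Φ x₀ + 1) / g y) * g x :=
        mul_le_mul_of_nonneg_left h1 (le_trans zero_le_one (le_max_left _ _))
      linarith [hbd x hx]
  have husc : UpperSemicontinuous fun x => Φ x - n * g x := by
    simp only [sub_eq_add_neg]
    exact hΦ.add (by fun_prop : Continuous fun x => -(n * g x)).upperSemicontinuous
  obtain ⟨w, hw, hwmax⟩ := (husc.upperSemicontinuousOn s).exists_isMaxOn ⟨x₀, hx₀⟩ hs
  have hw' : ∀ x ∈ s, Φ x - n * g x ≤ Φ w - n * g w := fun x hx => hwmax hx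
  have h0 := hw' x₀ hx₀
  rw [hgx₀, mul_zero, sub_zero] at h0
  have hlt : Φ w + d w < Φ x₀ + ε := by
    by_contra! h
    linarith [hn w hw h]
  have hng : 0 ≤ n * g w := mul_nonneg (by linarith) (hg0 w)
  exact ⟨n, hn1, w, hw, hw', by linarith [hd0 w], by linarith⟩

/-- Controlled dynamics and running costs on the branches of a junction, in the coordinates
`(s, z)`, where `s` is the position along the interface `z = 0` and `z` is the distance to it. -/
structure Dynamics (ι A : Type*) where
  ctrl : ι → Set A
  b₀ : ι → ℝ → ℝ → A → ℝ
  b₁ : ι → ℝ → ℝ → A → ℝ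
  cost : ι → ℝ → ℝ → A → ℝ
  lam : ℝ
  M : ℝ
  K : ℝ
  δ : ℝ
  lam_pos : 0 < lam
  one_le_M : 1 ≤ M
  K_nonneg : 0 ≤ K
  δ_pos : 0 < δ
  abs_b₀_le : ∀ i s z, ∀ a ∈ ctrl i, |b₀ i s z a| ≤ M
  abs_b₁_le : ∀ i s z, ∀ a ∈ ctrl i, |b₁ i s z a| ≤ M
  abs_cost_le : ∀ i s z, ∀ a ∈ ctrl i, |cost i s z a| ≤ M
  b₀_lip : ∀ i s z s' z', ∀ a ∈ ctrl i,
    |b₀ i s z a - b₀ i s' z' a| ≤ K * (|s - s'| + |z - z'|)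
  b₁_lip : ∀ i s z s' z', ∀ a ∈ ctrl i,
    |b₁ i s z a - b₁ i s' z' a| ≤ K * (|s - s'| + |z - z'|)
  cost_equicont : ∀ i s z ε, 0 < ε → ∃ r > 0, ∀ s' z', |s' - s| < r → |z' - z| < r →
    ∀ a ∈ ctrl i, |cost i s' z' a - cost i s z a| < ε
  mix : ∀ i s, ∀ a ∈ ctrl i, ∀ a' ∈ ctrl i, ∀ τ : ℝ, 0 ≤ τ → τ ≤ 1 → ∃ a'' ∈ ctrl i,
    b₀ i s 0 a'' = (1 - τ) * b₀ i s 0 a + τ * b₀ i s 0 a' ∧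
    b₁ i s 0 a'' = (1 - τ) * b₁ i s 0 a + τ * b₁ i s 0 a' ∧
    cost i s 0 a'' = (1 - τ) * cost i s 0 a + τ * cost i s 0 a'
  inward : ∀ i s, ∃ a ∈ ctrl i, b₁ i s 0 a = δ
  outward : ∀ i s, ∃ a ∈ ctrl i, b₁ i s 0 a = -δ

/-- Bounded viscosity subsolutions in coordinates, tested against quadratic polynomials. -/
structure IsSub {ι A : Type*} (D : Dynamics ι A) (U : ι → ℝ → ℝ → ℝ) : Prop where
  usc : ∀ i, UpperSemicontinuous fun p : ℝ × ℝ => U i p.1 p.2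
  bounded : ∀ i s z, |U i s z| ≤ D.M
  trace : ∀ i j s, U i s 0 = U j s 0
  interior : ∀ i s z, 0 < z → ∀ p q A B C : ℝ,
    (∃ r > 0, ∀ s' z', |s' - s| < r → |z' - z| < r → U i s' z' ≤ U i s z + p * (s' - s)
      + q * (z' - z) + A * (s' - s) ^ 2 + B * (z' - z) ^ 2 + C * (s' - s) * (z' - z)) →
    ∀ a ∈ D.ctrl i, D.lam * U i s z - p * D.b₀ i s z a - q * D.b₁ i s z a - D.cost i s z a ≤ 0
  interface : ∀ s, ∀ p A : ℝ, ∀ q B C : ι → ℝ,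
    (∀ j, ∃ r > 0, ∀ s' z', |s' - s| < r → 0 ≤ z' → z' < r → U j s' z' ≤ U j s 0 + p * (s' - s)
      + q j * z' + A * (s' - s) ^ 2 + B j * z' ^ 2 + C j * (s' - s) * z') →
    ∀ i, ∀ a ∈ D.ctrl i, 0 ≤ D.b₁ i s 0 a →
      D.lam * U i s 0 - p * D.b₀ i s 0 a - q i * D.b₁ i s 0 a - D.cost i s 0 a ≤ 0

/-- Bounded viscosity supersolutions in coordinates, tested against quadratic polynomials. -/
structure IsSuper {ι A : Type*} (D : Dynamics ι A) (V : ι → ℝ → ℝ → ℝ) : Prop where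
  lsc : ∀ i, LowerSemicontinuous fun p : ℝ × ℝ => V i p.1 p.2
  bounded : ∀ i s z, |V i s z| ≤ D.M
  trace : ∀ i j s, V i s 0 = V j s 0
  interior : ∀ i s z, 0 < z → ∀ p q A B : ℝ,
    (∃ r > 0, ∀ s' z', |s' - s| < r → |z' - z| < r → V i s z + p * (s' - s)
      + q * (z' - z) + A * (s' - s) ^ 2 + B * (z' - z) ^ 2 ≤ V i s' z') →
    ∃ a ∈ D.ctrl i,
      0 ≤ D.lam * V i s z - p * D.b₀ i s z a - q * D.b₁ i s z a - D.cost i s z a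
  interface : ∀ s, ∀ p A : ℝ, ∀ q B : ι → ℝ,
    (∀ j, ∃ r > 0, ∀ s' z', |s' - s| < r → 0 ≤ z' → z' < r → V j s 0 + p * (s' - s)
      + q j * z' + A * (s' - s) ^ 2 + B j * z' ^ 2 ≤ V j s' z') →
    ∃ i, ∃ a ∈ D.ctrl i, 0 ≤ D.b₁ i s 0 a ∧
      0 ≤ D.lam * V i s 0 - p * D.b₀ i s 0 a - q i * D.b₁ i s 0 a - D.cost i s 0 a

section
variable {ι A : Type*} {D : Dynamics ι A} {U V : ι → ℝ → ℝ → ℝ}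

theorem abs_mul_le_of_le {x y a b : ℝ} (hx : |x| ≤ a) (hy : |y| ≤ b) : |x * y| ≤ a * b := by
  rw [abs_mul]
  exact mul_le_mul hx hy (abs_nonneg y) ((abs_nonneg x).trans hx)

theorem IsSub.exists_pos_lt (hU : IsSub D U) {i : ι} {s z c : ℝ} (h : U i s z < c) :
    ∃ r > 0, ∀ s' z', |s' - s| < r → |z' - z| < r → U i s' z' < c := by
  obtain ⟨r, hr, hb⟩ := Metric.eventually_nhds_iff.1 (hU.usc i (s, z) c h)
  refine ⟨r, hr, fun s' z' hs hz => hb (y := (s', z')) ?_⟩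
  rw [Prod.dist_eq, Real.dist_eq, Real.dist_eq]
  exact max_lt hs hz

theorem IsSub.exists_max (hU : IsSub D U) (i : ι) {s : Set (ℝ × ℝ)} (hs : IsCompact s)
    {x₀ : ℝ × ℝ} (hx₀ : x₀ ∈ s) {g : ℝ × ℝ → ℝ} (hg : Continuous g) :
    ∃ p ∈ s, ∀ p' ∈ s, U i p'.1 p'.2 - g p' ≤ U i p.1 p.2 - g p := by
  obtain ⟨p, hp, hmax⟩ := (((hU.usc i).add hg.neg.upperSemicontinuous).upperSemicontinuousOn
    s).exists_isMaxOn ⟨x₀, hx₀⟩ hs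
  exact ⟨p, hp, fun p' hp' => by simpa [sub_eq_add_neg] using hmax hp'⟩

/-- Upper barrier on a branch: near the interface a subsolution grows at most at the rate
allowed by the outward controls. -/
theorem IsSub.barrier (hU : IsSub D U) (j : ι) {x ρ P Q W R : ℝ} (hρ : 0 < ρ)
    (hbase : ∀ t, |t - x| ≤ ρ → U j t 0 ≤ W + P * (t - x) + Q * (t - x) ^ 2)
    (hside : ∀ t, |t - x| = ρ → U j t 0 < W + P * (t - x) + Q * (t - x) ^ 2)
    (hR : D.lam * D.M + D.M + (|P| + 2 * |Q| * ρ) * D.M < R * (D.δ / 2)) :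
    ∃ B, ∃ ρ' > 0, ∀ t z, |t - x| ≤ ρ → 0 ≤ z → z ≤ ρ' →
      U j t z ≤ W + P * (t - x) + Q * (t - x) ^ 2 + R * z + B * z ^ 2 := by
  have hδ := D.δ_pos
  have hK := D.K_nonneg
  have hM := D.one_le_M
  have hlam := D.lam_pos
  have hRpos : 0 < R := by
    by_contra! h
    have : R * (D.δ / 2) ≤ 0 := mul_nonpos_of_nonpos_of_nonneg h (by linarith)
    have : 0 ≤ D.lam * D.M + D.M + (|P| + 2 * |Q| * ρ) * D.M := by positivity
    linarith
  obtain ⟨η₁, hη₁, h₁⟩ := hU.exists_pos_lt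
    (hside _ (by rw [add_sub_cancel_left, abs_of_pos hρ]))
  obtain ⟨η₂, hη₂, h₂⟩ := hU.exists_pos_lt
    (hside _ (by rw [sub_sub_cancel_left, abs_neg, abs_of_pos hρ]))
  obtain ⟨ρ', hρ', hρ'1, hρ'2, hρ'3⟩ : ∃ ρ' > 0, ρ' < η₁ ∧ ρ' < η₂ ∧ D.K * ρ' ≤ D.δ / 2 := by
    have h3 : 0 < D.δ / (2 * (D.K + 1)) := by positivity
    refine ⟨min (min (η₁ / 2) (η₂ / 2)) (D.δ / (2 * (D.K + 1))), by positivity, ?_, ?_, ?_⟩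
    · linarith [min_le_left (min (η₁ / 2) (η₂ / 2)) (D.δ / (2 * (D.K + 1))),
        min_le_left (η₁ / 2) (η₂ / 2)]
    · linarith [min_le_left (min (η₁ / 2) (η₂ / 2)) (D.δ / (2 * (D.K + 1))),
        min_le_right (η₁ / 2) (η₂ / 2)]
    · calc D.K * min (min (η₁ / 2) (η₂ / 2)) (D.δ / (2 * (D.K + 1)))
          ≤ (D.K + 1) * (D.δ / (2 * (D.K + 1))) :=
            mul_le_mul (by linarith) (min_le_right _ _) (by positivity) (by linarith)
        _ = D.δ / 2 := by field_simp
  obtain ⟨B, hB0, hB⟩ : ∃ B, 0 ≤ B ∧ B * ρ' ^ 2 = D.M + |W| + |P| * ρ + |Q| * ρ ^ 2 + 1 :=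
    ⟨(D.M + |W| + |P| * ρ + |Q| * ρ ^ 2 + 1) / ρ' ^ 2, by positivity,
      div_mul_cancel₀ _ (by positivity)⟩
  refine ⟨B, ρ', hρ', ?_⟩
  obtain ⟨⟨t, z⟩, ⟨ht, hz⟩, hmax⟩ := hU.exists_max j
    (isCompact_Icc.prod isCompact_Icc : IsCompact (Icc (x - ρ) (x + ρ) ×ˢ Icc 0 ρ'))
    (x₀ := (x, 0)) ⟨⟨by simp [hρ.le], by simp [hρ.le]⟩, ⟨le_rfl, hρ'.le⟩⟩
    (by fun_prop : Continuous fun p : ℝ × ℝ =>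
      P * (p.1 - x) + Q * (p.1 - x) ^ 2 + R * p.2 + B * p.2 ^ 2)
  have hmax' : ∀ t' z', |t' - x| ≤ ρ → 0 ≤ z' → z' ≤ ρ' →
      U j t' z' - (P * (t' - x) + Q * (t' - x) ^ 2 + R * z' + B * z' ^ 2)
        ≤ U j t z - (P * (t - x) + Q * (t - x) ^ 2 + R * z + B * z ^ 2) := by
    intro t' z' ht' h0 h1
    rw [abs_le] at ht'
    exact hmax (t', z') ⟨⟨by linarith, by linarith⟩, ⟨h0, h1⟩⟩
  by_contra! hcon
  obtain ⟨t₁, z₁, ht₁, hz₁, hz₁', hlt⟩ := hcon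
  have hW := hmax' t₁ z₁ ht₁ hz₁ hz₁'
  simp only [mem_Icc] at ht hz
  have htx : |t - x| ≤ ρ := abs_le.2 ⟨by linarith, by linarith⟩
  have hUt := abs_le.1 (hU.bounded j t z)
  have hRz : 0 ≤ R * z := mul_nonneg hRpos.le hz.1
  have hBz : 0 ≤ B * z ^ 2 := mul_nonneg hB0 (sq_nonneg z)
  have hPt := abs_le.1 (abs_mul_le_of_le (le_refl |P|) htx)
  have hQt := abs_le.1 (abs_mul_le_of_le (le_refl |Q|) (by
    rw [abs_pow]; exact pow_le_pow_left₀ (abs_nonneg _) htx 2 : |(t - x) ^ 2| ≤ ρ ^ 2))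
  have hz0 : 0 < z := by
    rcases hz.1.lt_or_eq with h0 | h0
    · exact h0
    · subst h0
      linarith [hbase t htx]
  have hzρ : z < ρ' := by
    rcases hz.2.lt_or_eq with h0 | h0
    · exact h0
    · subst h0
      linarith [neg_abs_le W, mul_pos hRpos hρ']
  have htρ : |t - x| < ρ := by
    rcases htx.lt_or_eq with h0 | h0
    · exact h0
    · have hzabs : |z - 0| = z := by rw [sub_zero, abs_of_pos hz0]
      rcases abs_cases (t - x) with ⟨h3, -⟩ | ⟨h3, -⟩
      · obtain rfl : t = x + ρ := by linarith
        have := h₁ (x + ρ) z (by simpa using hη₁) (by rw [hzabs]; linarith)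
        linarith
      · obtain rfl : t = x - ρ := by linarith
        have := h₂ (x - ρ) z (by simpa using hη₂) (by rw [hzabs]; linarith)
        linarith
  obtain ⟨a, ha, hb⟩ := D.outward j t
  have key := hU.interior j t z hz0 (P + 2 * Q * (t - x)) (R + 2 * B * z) Q B 0
    ⟨min (ρ - |t - x|) (min z (ρ' - z)),
      lt_min (by linarith) (lt_min hz0 (by linarith)), fun s' z' hs' hz' => by
      have h1 := (hs'.trans_le (min_le_left _ _))
      have h2 := abs_lt.1 (hz'.trans_le ((min_le_right _ _).trans (min_le_left _ _)))
      have h3 := abs_lt.1 (hz'.trans_le ((min_le_right _ _).trans (min_le_right _ _)))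
      have h4 : |s' - x| ≤ ρ := by
        have := abs_add_le (s' - t) (t - x)
        rw [sub_add_sub_cancel] at this
        linarith
      have h5 := hmax' s' z' h4 (by linarith) (by linarith)
      linarith⟩ a ha
  have hb1 := abs_le.1 (D.b₁_lip j t z t 0 a ha)
  have hKz : D.K * z ≤ D.K * ρ' := mul_le_mul_of_nonneg_left hzρ.le hK
  simp only [sub_self, abs_zero, sub_zero, abs_of_pos hz0, zero_add] at hb1
  have hbneg : D.b₁ j t z a ≤ -(D.δ / 2) := by linarith
  have hq : R * (D.δ / 2) ≤ (R + 2 * B * z) * -(D.b₁ j t z a) :=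
    mul_le_mul (by linarith [mul_nonneg hB0 hz0.le]) (by linarith) (by linarith) (by positivity)
  have hp : |P + 2 * Q * (t - x)| ≤ |P| + 2 * |Q| * ρ := by
    refine (abs_add_le _ _).trans ?_
    have : |2 * Q * (t - x)| ≤ 2 * |Q| * ρ :=
      abs_mul_le_of_le (by rw [abs_mul, abs_two]) htx
    linarith
  have hpb := abs_le.1 (abs_mul_le_of_le hp (D.abs_b₀_le j t z a ha))
  have hc := abs_le.1 (D.abs_cost_le j t z a ha)
  have hlU : -(D.lam * D.M) ≤ D.lam * U j t z := by
    have := mul_le_mul_of_nonneg_left hUt.1 hlam.le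
    linarith
  linarith

/-- A subsolution touched from above along the interface satisfies the inequality for all inward
controls, with an explicit normal slope `R`. -/
theorem IsSub.interface_le (hU : IsSub D U) {x ρ P Q R : ℝ} (hρ : 0 < ρ)
    (h : ∀ i t, |t - x| ≤ ρ → U i t 0 ≤ U i x 0 + P * (t - x) + Q * (t - x) ^ 2)
    (hR : D.lam * D.M + D.M + (|P| + 1) * D.M < R * (D.δ / 2)) :
    ∀ i, ∀ a ∈ D.ctrl i, 0 ≤ D.b₁ i x 0 a →
      D.lam * U i x 0 - P * D.b₀ i x 0 a - R * D.b₁ i x 0 a - D.cost i x 0 a ≤ 0 := by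
  obtain ⟨ρ₁, hρ₁, hle, hQ⟩ : ∃ ρ₁ > 0, ρ₁ ≤ ρ ∧ 2 * |Q + 1| * ρ₁ ≤ 1 := by
    refine ⟨min ρ (1 / (2 * |Q + 1| + 1)), by positivity, min_le_left _ _, ?_⟩
    calc 2 * |Q + 1| * min ρ (1 / (2 * |Q + 1| + 1))
        ≤ (2 * |Q + 1| + 1) * (1 / (2 * |Q + 1| + 1)) :=
          mul_le_mul (by linarith) (min_le_right _ _) (by positivity) (by positivity)
      _ = 1 := by field_simp
  have hM := D.one_le_M
  have hbar := fun j => hU.barrier j (x := x) (P := P) (Q := Q + 1) (W := U j x 0) (R := R) hρ₁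
    (fun t ht => by nlinarith [h j t (ht.trans hle), sq_nonneg (t - x)])
    (fun t ht => by
      have h1 : 0 < (t - x) ^ 2 := by rw [← sq_abs, ht]; positivity
      linarith [h j t (ht.le.trans hle)])
    (by
      have := mul_le_mul_of_nonneg_right hQ (by linarith : 0 ≤ D.M)
      linarith)
  choose B r hr hB using hbar
  refine hU.interface x P (Q + 1) (fun _ => R) B 0 fun j =>
    ⟨min ρ₁ (r j), lt_min hρ₁ (hr j), fun t z ht hz0 hz => ?_⟩
  have h1 := hB j t z (ht.le.trans (min_le_left _ _)) hz0 (hz.le.trans (min_le_right _ _))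
  simp only [Pi.zero_apply]
  linarith

theorem eventually_mul_lt (X : ℝ) {Y : ℝ} (hY : 0 < Y) : ∀ᶠ T in 𝓝[>] (0 : ℝ), X * T < Y := by
  have : Tendsto (fun T : ℝ => X * T) (𝓝[>] 0) (𝓝 (X * 0)) :=
    ((continuous_const.mul continuous_id).tendsto 0).mono_left nhdsWithin_le_nhds
  rw [mul_zero] at this
  exact this.eventually_lt_const hY

set_option maxHeartbeats 1000000 in
/-- Suboptimality along an inward control starting on the interface. -/
theorem IsSub.eventually_inward (hU : IsSub D U) {i : ι} {x : ℝ} {a : A} (ha : a ∈ D.ctrl i)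
    (hb : 0 < D.b₁ i x 0 a) {κ k c : ℝ} (hκ : 0 < κ) (hk : k * D.b₁ i x 0 a = D.b₀ i x 0 a)
    (hc : c * D.b₁ i x 0 a = D.lam * U i x 0 - D.cost i x 0 a - κ) :
    ∀ᶠ T in 𝓝[>] (0 : ℝ), ∃ t, |t - x - k * T| ≤ κ * T ∧ U i x 0 + c * T ≤ U i t T := by
  have hδ := D.δ_pos
  have hK := D.K_nonneg
  have hM := D.one_le_M
  have hlam := D.lam_pos
  set E := |k| + κ + 1 with hE
  have hEpos : 0 < E := by positivity
  obtain ⟨σ, hσ, hσκ⟩ : ∃ σ > 0, 2 * σ * ((1 + |k|) * (D.K * E)) ≤ κ / 4 * κ := by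
    refine ⟨κ ^ 2 / (8 * ((1 + |k|) * (D.K * E) + 1)), by positivity, ?_⟩
    have : 0 ≤ (1 + |k|) * (D.K * E) := by positivity
    calc 2 * (κ ^ 2 / (8 * ((1 + |k|) * (D.K * E) + 1))) * ((1 + |k|) * (D.K * E))
        ≤ 2 * (κ ^ 2 / (8 * ((1 + |k|) * (D.K * E) + 1))) * ((1 + |k|) * (D.K * E) + 1) := by
          gcongr; linarith
      _ = κ / 4 * κ := by field_simp; ring
  obtain ⟨r₁, hr₁, husc⟩ := hU.exists_pos_lt (i := i) (s := x) (z := 0)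
    (c := U i x 0 + σ / 2) (by linarith)
  obtain ⟨r₂, hr₂, hcost⟩ := D.cost_equicont i x 0 (κ / 4) (by positivity)
  filter_upwards [eventually_mul_lt E hr₁, eventually_mul_lt E hr₂,
    eventually_mul_lt |c| (by positivity : 0 < σ / 2), eventually_mul_lt (D.K * E) hb,
    eventually_mul_lt (D.lam * |c| + |c| * (D.K * E)) (by positivity : 0 < κ / 4),
    self_mem_nhdsWithin] with T hT₁ hT₂ hT₃ hT₄ hT₅ hT
  rw [mem_Ioi] at hT
  by_contra! hcon
  obtain ⟨m, hm0, hm⟩ : ∃ m, 0 < m ∧ m * (κ * T) ^ 2 = σ :=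
    ⟨σ / (κ * T) ^ 2, by positivity, div_mul_cancel₀ _ (by positivity)⟩
  have hmem : ∀ t z, 0 ≤ z → z ≤ T → |t - x - k * z| ≤ κ * T →
      (t, z) ∈ (fun p : ℝ × ℝ => (x + k * p.2 + p.1, p.2)) '' (Icc (-(κ * T)) (κ * T) ×ˢ Icc 0 T) :=
    fun t z h0 h1 h2 => ⟨(t - x - k * z, z), ⟨abs_le.1 h2, h0, h1⟩, by simp⟩
  obtain ⟨p, ⟨⟨e, z⟩, ⟨he, hz⟩, rfl⟩, hmax⟩ := hU.exists_max i
    ((isCompact_Icc.prod isCompact_Icc : IsCompact (Icc (-(κ * T)) (κ * T) ×ˢ Icc 0 T)).image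
      (by fun_prop : Continuous fun p : ℝ × ℝ => (x + k * p.2 + p.1, p.2)))
    (x₀ := (x, 0)) (hmem x 0 le_rfl hT.le (by simpa using by positivity))
    (by fun_prop : Continuous fun p : ℝ × ℝ => c * p.2 + m * (p.1 - x - k * p.2) ^ 2)
  simp only at hmax
  obtain ⟨t, ht⟩ : ∃ t, t = x + k * z + e := ⟨_, rfl⟩
  obtain rfl : e = t - x - k * z := by linarith
  rw [← ht] at hmax
  have hmax' : ∀ t' z', 0 ≤ z' → z' ≤ T → |t' - x - k * z'| ≤ κ * T →
      U i t' z' - (c * z' + m * (t' - x - k * z') ^ 2)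
        ≤ U i t z - (c * z + m * (t - x - k * z) ^ 2) :=
    fun t' z' h0 h1 h2 => hmax _ (hmem t' z' h0 h1 h2)
  clear hmax
  simp only [mem_Icc] at he hz
  have hex : |t - x - k * z| ≤ κ * T := abs_le.2 he
  have h0 := hmax' x 0 le_rfl hT.le (by simpa using by positivity)
  simp only [mul_zero, sub_self, sub_zero, ne_eq, OfNat.ofNat_ne_zero, not_false_eq_true,
    zero_pow, add_zero] at h0
  have hcz : |c * z| ≤ |c| * T := by
    rw [abs_mul, abs_of_nonneg hz.1]; exact mul_le_mul_of_nonneg_left hz.2 (abs_nonneg c)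
  have hcz' := abs_le.1 hcz
  have hme : 0 ≤ m * (t - x - k * z) ^ 2 := by positivity
  have htx : |t - x| ≤ (|k| + κ) * T := by
    have h1 : |t - x| ≤ |t - x - k * z| + |k * z| := by
      simpa using abs_add_le (t - x - k * z) (k * z)
    have h2 : |k * z| ≤ |k| * T := by
      rw [abs_mul, abs_of_nonneg hz.1]; exact mul_le_mul_of_nonneg_left hz.2 (abs_nonneg k)
    linarith
  have hET : |t - x| + z ≤ E * T := by rw [hE]; linarith [hz.2]
  have hzT : z < T := by
    rcases hz.2.lt_or_eq with h | h
    · exact h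
    · subst h
      linarith [hcon t hex]
  have heT : |t - x - k * z| < κ * T := by
    rcases hex.lt_or_eq with h | h
    · exact h
    · have h1 : m * (t - x - k * z) ^ 2 = σ := by rw [← sq_abs, h, hm]
      have h2 := husc t z (by linarith [hz.1]) (by
        rw [sub_zero, abs_of_nonneg hz.1]; linarith [abs_nonneg (t - x)])
      linarith
  have key : D.lam * U i t z - 2 * m * (t - x - k * z) * D.b₀ i t z a
      - (c - 2 * m * (t - x - k * z) * k) * D.b₁ i t z a - D.cost i t z a ≤ 0 := by
    obtain ⟨r, hr, hrz, hre⟩ : ∃ r > 0, r ≤ T - z ∧ r * (1 + |k|) ≤ κ * T - |t - x - k * z| := by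
      refine ⟨min (T - z) ((κ * T - |t - x - k * z|) / (1 + |k|)),
        lt_min (by linarith) (div_pos (by linarith) (by positivity)), min_le_left _ _, ?_⟩
      rw [← le_div_iff₀ (by positivity)]; exact min_le_right _ _
    have hloc : ∀ s' z', |s' - t| < r → |z' - z| < r → 0 ≤ z' → U i s' z' ≤ U i t z
        + 2 * m * (t - x - k * z) * (s' - t) + (c - 2 * m * (t - x - k * z) * k) * (z' - z)
        + m * (s' - t) ^ 2 + m * k ^ 2 * (z' - z) ^ 2 + -(2 * m * k) * (s' - t) * (z' - z) := by
      intro s' z' hs' hz' hz0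
      have h1 : |s' - x - k * z'| ≤ κ * T := by
        have h2 : s' - x - k * z' = (t - x - k * z) + ((s' - t) + -(k * (z' - z))) := by ring
        have h3 : |k * (z' - z)| ≤ |k| * r := abs_mul_le_of_le le_rfl hz'.le
        rw [h2]
        refine (abs_add_le _ _).trans ?_
        have h4 := abs_add_le (s' - t) (-(k * (z' - z)))
        rw [abs_neg] at h4
        linarith
      have h2 := hmax' s' z' hz0 (by linarith [(abs_lt.1 hz').2]) h1
      linarith
    rcases hz.1.lt_or_eq with hz0 | hz0
    · exact hU.interior i t z hz0 _ _ m (m * k ^ 2) (-(2 * m * k))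
        ⟨min r z, lt_min hr hz0, fun s' z' hs' hz' => hloc s' z' (hs'.trans_le (min_le_left _ _))
          (hz'.trans_le (min_le_left _ _))
          (by linarith [(abs_lt.1 (hz'.trans_le (min_le_right r z))).1])⟩ a ha
    · subst hz0
      simp only [mul_zero, sub_zero, zero_add, add_zero] at *
      obtain ⟨R, hR⟩ : ∃ R, R * (D.δ / 2) =
          D.lam * D.M + D.M + (|(0 : ℝ)| + 2 * |m| * (κ * T)) * D.M + 1 :=
        ⟨_, div_mul_cancel₀ _ (by positivity)⟩
      have hbar := fun j => hU.barrier j (x := x) (P := 0) (Q := m)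
        (W := U i t 0 - m * (t - x) ^ 2) (R := R) (by positivity : 0 < κ * T)
        (fun t' ht' => by
          have := hmax' t' 0 le_rfl hT.le (by simpa using ht')
          rw [hU.trace j i]
          simp only [mul_zero, sub_zero, zero_add] at this
          linarith)
        (fun t' ht' => by
          have h1 : m * (t' - x) ^ 2 = σ := by rw [← sq_abs, ht', hm]
          rw [hU.trace j i]
          have h2 : κ * T ≤ E * T := mul_le_mul_of_nonneg_right
            (by rw [hE]; linarith [abs_nonneg k]) hT.le
          have := husc t' 0 (by linarith) (by simpa using hr₁)
          linarith)
        (by linarith)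
      choose B r' hr' hB using hbar
      classical
      have hin : 0 ≤ D.b₁ i t 0 a := by
        have h1 := abs_le.1 (D.b₁_lip i t 0 x 0 a ha)
        simp only [sub_self, abs_zero, add_zero] at h1
        have h2 : D.K * |t - x| ≤ D.K * (E * T) := mul_le_mul_of_nonneg_left hET hK
        linarith
      have := hU.interface t (2 * m * (t - x)) m
        (fun j => if j = i then c - 2 * m * (t - x) * k else R)
        (fun j => if j = i then m * k ^ 2 else B j)
        (fun j => if j = i then -(2 * m * k) else 0) (fun j => by
          by_cases hj : j = i
          · subst hj
            refine ⟨r, hr, fun s' z' hs' h0 hz' => ?_⟩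
            have := hloc s' z' hs' (by rwa [abs_of_nonneg h0]) h0
            simpa using this
          · refine ⟨min (r' j) (κ * T - |t - x|), lt_min (hr' j) (by linarith),
              fun s' z' hs' h0 hz' => ?_⟩
            simp only [hj, if_false]
            have h1 := hs'.trans_le (min_le_right _ _)
            have h2 : |s' - x| ≤ κ * T := by
              have := abs_add_le (s' - t) (t - x)
              rw [sub_add_sub_cancel] at this
              linarith
            have h3 := hB j s' z' h2 h0 (hz'.le.trans (min_le_left _ _))
            rw [hU.trace j i t]
            linarith) i a ha hin
      simpa using this
  have hlip0 := abs_le.1 (D.b₀_lip i t z x 0 a ha)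
  have hlip1 := D.b₁_lip i t z x 0 a ha
  rw [sub_zero, abs_of_nonneg hz.1] at hlip0 hlip1
  have hKE : D.K * (|t - x| + z) ≤ D.K * (E * T) := mul_le_mul_of_nonneg_left hET hK
  have hlip1' : |D.b₁ i t z a - D.b₁ i x 0 a| ≤ D.K * (E * T) := hlip1.trans hKE
  have hdrift : |D.b₀ i t z a - k * D.b₁ i t z a| ≤ (1 + |k|) * (D.K * (E * T)) := by
    have h1 : D.b₀ i t z a - k * D.b₁ i t z a =
        (D.b₀ i t z a - D.b₀ i x 0 a) + -(k * (D.b₁ i t z a - D.b₁ i x 0 a)) := by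
      rw [← hk]; ring
    rw [h1]
    refine (abs_add_le _ _).trans ?_
    rw [abs_neg]
    have h2 := abs_mul_le_of_le (le_refl |k|) hlip1'
    have h3 := abs_le.2 hlip0
    linarith
  have hslope : |2 * m * (t - x - k * z)| ≤ 2 * m * (κ * T) := by
    rw [abs_mul, abs_of_pos (by positivity : 0 < 2 * m)]
    exact mul_le_mul_of_nonneg_left hex (by positivity)
  have hprod := (abs_le.1 (abs_mul_le_of_le hslope hdrift)).2
  have hsmall : 2 * m * (κ * T) * ((1 + |k|) * (D.K * (E * T))) ≤ κ / 4 := by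
    have h1 : 2 * m * (κ * T) * ((1 + |k|) * (D.K * (E * T))) * κ =
        2 * (m * (κ * T) ^ 2) * ((1 + |k|) * (D.K * E)) := by ring
    rw [hm] at h1
    exact le_of_mul_le_mul_right (h1.trans_le hσκ) hκ
  have hcb := (abs_le.1 (abs_mul_le_of_le (le_refl |c|) hlip1')).2
  have hco := abs_lt.1 (hcost t z (by linarith [hz.1]) (by
        rw [sub_zero, abs_of_nonneg hz.1]; linarith [abs_nonneg (t - x)]) a ha)
  have hlU : D.lam * (U i x 0 - |c| * T) ≤ D.lam * U i t z :=
    mul_le_mul_of_nonneg_left (by linarith) hlam.le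
  have hsplit : 2 * m * (t - x - k * z) * D.b₀ i t z a
      + (c - 2 * m * (t - x - k * z) * k) * D.b₁ i t z a =
      2 * m * (t - x - k * z) * (D.b₀ i t z a - k * D.b₁ i t z a)
      + c * (D.b₁ i t z a - D.b₁ i x 0 a) + c * D.b₁ i x 0 a := by ring
  have hT₅' : D.lam * |c| * T + |c| * (D.K * (E * T)) < κ / 4 := lt_of_eq_of_lt (by ring) hT₅
  clear hmax' hcon husc hcost hU hm
  linarith [hco.2, hprod, hsmall]

theorem IsSuper.neg_usc (hV : IsSuper D V) (i : ι) :
    UpperSemicontinuous fun p : ℝ × ℝ => -V i p.1 p.2 :=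
  continuous_neg.comp_lowerSemicontinuous_antitone (hV.lsc i) fun _ _ h => neg_le_neg h

theorem le_of_forall_small {a b C : ℝ} (h : ∃ ρ > 0, ∀ r, 0 < r → r < ρ → a ≤ b + C * r) :
    a ≤ b := by
  obtain ⟨ρ, hρ, h⟩ := h
  by_contra! hab
  have hC : 0 < |C| + 1 := by positivity
  have hr : 0 < min (ρ / 2) ((a - b) / (2 * (|C| + 1))) :=
    lt_min (by linarith) (div_pos (by linarith) (by positivity))
  have h1 := h _ hr ((min_le_left _ _).trans_lt (by linarith))
  have h2 := mul_le_mul_of_nonneg_left (min_le_right (ρ / 2) ((a - b) / (2 * (|C| + 1)))) hC.le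
  have h3 : (|C| + 1) * ((a - b) / (2 * (|C| + 1))) = (a - b) / 2 := by field_simp
  have h4 := mul_le_mul_of_nonneg_right (le_abs_self C) hr.le
  linarith

/-- A maximum point of `U - V - Θ` away from the interface, for a quadratic doubling penalization
`Θ`, gives the sub- and supersolution inequalities. -/
theorem doubling_interior (hU : IsSub D U) (hV : IsSuper D V) {i : ι}
    {α s₀ z₀ x y w n m s z s' z' : ℝ} (hz : 0 < z) (hz' : 0 < z')
    (hmax : ∃ ρ > 0, ∀ t₁ y₁ t₂ y₂, |t₁ - s| < ρ → |y₁ - z| < ρ → |t₂ - s'| < ρ → |y₂ - z'| < ρ →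
      U i t₁ y₁ - V i t₂ y₂ - (α * (t₁ ^ 2 + y₁ ^ 2) + (t₁ - s₀) ^ 2 + (y₁ - z₀) ^ 2
        + (t₁ - x) ^ 2 + (t₂ - y) ^ 2 + (y₁ - w) ^ 2 + n * (t₁ - t₂) ^ 2 + m * (y₁ - y₂) ^ 2) ≤
      U i s z - V i s' z' - (α * (s ^ 2 + z ^ 2) + (s - s₀) ^ 2 + (z - z₀) ^ 2
        + (s - x) ^ 2 + (s' - y) ^ 2 + (z - w) ^ 2 + n * (s - s') ^ 2 + m * (z - z') ^ 2)) :
    (∀ a ∈ D.ctrl i, D.lam * U i s z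
      - (2 * α * s + 2 * (s - s₀) + 2 * (s - x) + 2 * n * (s - s')) * D.b₀ i s z a
      - (2 * α * z + 2 * (z - z₀) + 2 * (z - w) + 2 * m * (z - z')) * D.b₁ i s z a
      - D.cost i s z a ≤ 0) ∧
    ∃ a ∈ D.ctrl i, 0 ≤ D.lam * V i s' z' - (2 * n * (s - s') - 2 * (s' - y)) * D.b₀ i s' z' a
      - (2 * m * (z - z')) * D.b₁ i s' z' a - D.cost i s' z' a := by
  obtain ⟨ρ, hρ, hmax⟩ := hmax
  constructor
  · refine hU.interior i s z hz _ _ (α + 2 + n) (α + 2 + m) 0 ⟨ρ, hρ, fun t₁ y₁ h₁ h₂ => ?_⟩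
    have := hmax t₁ y₁ s' z' h₁ h₂ (by simpa) (by simpa)
    linarith
  · refine hV.interior i s' z' hz' _ _ (-n - 1) (-m) ⟨ρ, hρ, fun t₂ y₂ h₁ h₂ => ?_⟩
    have := hmax s z t₂ y₂ (by simpa) (by simpa) h₁ h₂
    linarith

theorem Dynamics.sub_le_of_slopes (D : Dynamics ι A) {i : ι} {a : A} (ha : a ∈ D.ctrl i)
    {s z s' z' P Q p q l l' : ℝ}
    (h : l - P * D.b₀ i s z a - Q * D.b₁ i s z a - D.cost i s z a ≤ 0)
    (h' : 0 ≤ l' - p * D.b₀ i s' z' a - q * D.b₁ i s' z' a - D.cost i s' z' a) :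
    l - l' ≤ (|P - p| + |Q - q|) * D.M + (|P| + |Q|) * (D.K * (|s - s'| + |z - z'|))
      + |D.cost i s z a - D.cost i s' z' a| := by
  have h0 := (abs_le.1 (abs_mul_le_of_le (le_refl |P|) (D.b₀_lip i s z s' z' a ha))).2
  have h1 := (abs_le.1 (abs_mul_le_of_le (le_refl |Q|) (D.b₁_lip i s z s' z' a ha))).2
  have h2 := (abs_le.1 (abs_mul_le_of_le (le_refl |P - p|) (D.abs_b₀_le i s' z' a ha))).2
  have h3 := (abs_le.1 (abs_mul_le_of_le (le_refl |Q - q|) (D.abs_b₁_le i s' z' a ha))).2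
  have h4 := le_abs_self (D.cost i s z a - D.cost i s' z' a)
  linarith

set_option maxHeartbeats 1000000 in
/-- The comparison estimate at a maximum point away from the interface. -/
theorem estimate_interior (hU : IsSub D U) (hV : IsSuper D V) {i : ι} {α β μ s₀ z₀ : ℝ}
    (hz₀ : 0 < z₀) (hα : 0 < α) (hα1 : α ≤ 1) (hβ1 : β ≤ 1) (hs₀β : α * |s₀| ≤ β)
    (hz₀β : α * z₀ ≤ β) (hμ : μ ≤ U i s₀ z₀ - V i s₀ z₀ - α * (s₀ ^ 2 + z₀ ^ 2))
    (hmax : ∀ s z, 0 ≤ z → U i s z - V i s z - α * (s ^ 2 + z ^ 2) ≤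
      U i s₀ z₀ - V i s₀ z₀ - α * (s₀ ^ 2 + z₀ ^ 2)) :
    D.lam * μ ≤ 4 * D.M * β := by
  have hM := D.one_le_M
  have hK := D.K_nonneg
  refine le_of_forall_pos_le_add fun ε hε => ?_
  obtain ⟨R, hR, hcost⟩ := D.cost_equicont i s₀ z₀ (ε / 2) (by positivity)
  refine le_of_forall_small (C := 16 * D.M + 36 * D.K)
    ⟨min (R / 2) (min (z₀ / 4) 1), by positivity, fun r hr hrρ => ?_⟩
  obtain ⟨hrR, hrz, hr1⟩ : r < R / 2 ∧ r < z₀ / 4 ∧ r < 1 := by simpa using hrρ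
  have hcpt : IsCompact (Icc (s₀ - 4) (s₀ + 4) ×ˢ Icc (z₀ / 8) (z₀ + z₀) ×ˢ
      Icc (s₀ - 4) (s₀ + 4) ×ˢ Icc (z₀ / 8) (z₀ + z₀)) :=
    isCompact_Icc.prod (isCompact_Icc.prod (isCompact_Icc.prod isCompact_Icc))
  have husc : UpperSemicontinuous fun p : ℝ × ℝ × ℝ × ℝ => U i p.1 p.2.1
      + -V i p.2.2.1 p.2.2.2 + -(α * (p.1 ^ 2 + p.2.1 ^ 2) + (p.1 - s₀) ^ 2 + (p.2.1 - z₀) ^ 2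
        + (p.1 - s₀) ^ 2 + (p.2.2.1 - s₀) ^ 2 + (p.2.1 - z₀) ^ 2) :=
    (((hU.usc i).comp (by fun_prop : Continuous fun p : ℝ × ℝ × ℝ × ℝ => (p.1, p.2.1))).add
      ((hV.neg_usc i).comp (by fun_prop : Continuous fun p : ℝ × ℝ × ℝ × ℝ => p.2.2))).add
      (by fun_prop : Continuous fun p : ℝ × ℝ × ℝ × ℝ => -(α * (p.1 ^ 2 + p.2.1 ^ 2)
        + (p.1 - s₀) ^ 2 + (p.2.1 - z₀) ^ 2 + (p.1 - s₀) ^ 2 + (p.2.2.1 - s₀) ^ 2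
        + (p.2.1 - z₀) ^ 2)).upperSemicontinuous
  obtain ⟨n, hn, ⟨s, z, s', z'⟩, hmem, hw, hpen, hdist⟩ := exists_maximizer_penalized hcpt husc
    (g := fun p => (p.1 - p.2.2.1) ^ 2 + (p.2.1 - p.2.2.2) ^ 2)
    (d := fun p => (p.1 - s₀) ^ 2 + (p.2.1 - z₀) ^ 2) (by fun_prop) (by fun_prop)
    (fun p => by positivity) (fun p => by positivity) (x₀ := (s₀, z₀, s₀, z₀))
    (by simp only [mem_prod, mem_Icc]; refine ⟨⟨?_, ?_⟩, ⟨?_, ?_⟩, ⟨?_, ?_⟩, ?_, ?_⟩ <;> linarith)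
    (by simp) (by
      rintro ⟨s, z, s', z'⟩ hmem h0
      simp only [mem_prod, mem_Icc] at hmem
      simp only at h0
      obtain rfl : s' = s := by nlinarith [sq_nonneg (s - s'), sq_nonneg (z - z')]
      obtain rfl : z' = z := by nlinarith [sq_nonneg (z - z')]
      have := hmax s' z' (by linarith [hmem.2.1.1])
      simp only [sub_self]
      nlinarith [sq_nonneg (s' - s₀), sq_nonneg (z' - z₀)]) (pow_pos hr 2)
  have hw0 := hw (s₀, z₀, s₀, z₀) (by
    simp only [mem_prod, mem_Icc]; refine ⟨⟨?_, ?_⟩, ⟨?_, ?_⟩, ⟨?_, ?_⟩, ?_, ?_⟩ <;> linarith)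
  simp only [mem_prod, mem_Icc] at hmem
  simp only at hw hpen hdist hw0
  have hsx : |s - s₀| < r := abs_lt_of_sq_lt_sq (by nlinarith [sq_nonneg (z - z₀)]) hr.le
  have hzx : |z - z₀| < r := abs_lt_of_sq_lt_sq (by nlinarith [sq_nonneg (s - s₀)]) hr.le
  have hs : |s - s'| < r := abs_lt_of_sq_lt_sq (by
    nlinarith only [sq_nonneg (z - z'), sq_nonneg (s - s'), hn, hpen]) hr.le
  have hz : |z - z'| < r := abs_lt_of_sq_lt_sq (by
    nlinarith only [sq_nonneg (z - z'), sq_nonneg (s - s'), hn, hpen]) hr.le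
  have hs'x : |s' - s₀| < 2 * r := by rw [abs_lt] at hs hsx ⊢; constructor <;> linarith
  have hz'x : |z' - z₀| < 2 * r := by rw [abs_lt] at hz hzx ⊢; constructor <;> linarith
  have hsα : |α * s| ≤ β + r := by
    rw [abs_mul, abs_of_pos hα]
    have h1 : |s| ≤ |s₀| + r := by
      have := abs_add_le s₀ (s - s₀)
      rw [add_sub_cancel] at this
      linarith
    have h2 := mul_le_mul_of_nonneg_left h1 hα.le
    have h3 := mul_le_mul_of_nonneg_right hα1 hr.le
    linarith
  have hzα : |α * z| ≤ β + r := by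
    have h1 := abs_lt.1 hzx
    rw [abs_of_nonneg (mul_nonneg hα.le (by linarith))]
    have h2 := mul_le_mul_of_nonneg_left (by linarith : z ≤ z₀ + r) hα.le
    have h3 := mul_le_mul_of_nonneg_right hα1 hr.le
    linarith
  have hns : n * (|s - s'| + |z - z'|) * (|s - s'| + |z - z'|) ≤ 2 * r ^ 2 := by
    have h1 := sq_abs (s - s')
    have h2 := sq_abs (z - z')
    have h3 := mul_nonneg (by linarith : 0 ≤ n) (sq_nonneg (|s - s'| - |z - z'|))
    rw [← h1, ← h2] at hpen
    linarith
  have hval : μ ≤ U i s z - V i s' z' := by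
    have h1 : 0 ≤ α * (s ^ 2 + z ^ 2) := by positivity
    have h2 : 0 ≤ n * ((s - s') ^ 2 + (z - z') ^ 2) := by positivity
    linarith only [hw0, hμ, h1, h2, sq_nonneg (s - s₀), sq_nonneg (s' - s₀), sq_nonneg (z - z₀)]
  rw [abs_lt] at hs'x hz'x
  have hsx' := abs_lt.1 hsx
  have hzx' := abs_lt.1 hzx
  obtain ⟨hsub, a, ha, hsup⟩ := doubling_interior hU hV (i := i) (α := α) (s₀ := s₀) (z₀ := z₀)
    (x := s₀) (y := s₀) (w := z₀) (n := n) (m := n) (s := s) (z := z) (s' := s') (z' := z')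
    (by linarith) (by linarith) ⟨min r (z₀ / 8), by positivity, fun t₁ y₁ t₂ y₂ h₁ h₂ h₃ h₄ => by
      rw [lt_min_iff, abs_lt, abs_lt] at h₁ h₂ h₃ h₄
      have := hw (t₁, y₁, t₂, y₂) (by
        simp only [mem_prod, mem_Icc]
        refine ⟨⟨?_, ?_⟩, ⟨?_, ?_⟩, ⟨?_, ?_⟩, ?_, ?_⟩ <;> linarith)
      simp only at this
      linarith⟩
  have hest := D.sub_le_of_slopes ha (hsub a ha) hsup
  clear hw hw0 hsub hsup hmax husc hcpt hpen hdist
  have hc1 := abs_lt.1 (hcost s z (by linarith) (by linarith) a ha)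
  have hc2 := abs_lt.1 (hcost s' z' (abs_lt.2 ⟨by linarith, by linarith⟩)
    (abs_lt.2 ⟨by linarith, by linarith⟩) a ha)
  have hc : |D.cost i s z a - D.cost i s' z' a| ≤ ε := abs_le.2 ⟨by linarith, by linarith⟩
  rw [abs_le] at hsα hzα
  have hd1 : |2 * α * s + 2 * (s - s₀) + 2 * (s - s₀) + 2 * n * (s - s')
      - (2 * n * (s - s') - 2 * (s' - s₀))| ≤ 2 * β + 10 * r :=
    abs_le.2 ⟨by linarith, by linarith⟩
  have hd2 : |2 * α * z + 2 * (z - z₀) + 2 * (z - z₀) + 2 * n * (z - z')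
      - 2 * n * (z - z')| ≤ 2 * β + 6 * r :=
    abs_le.2 ⟨by linarith, by linarith⟩
  have hns' : |n * (s - s')| = n * |s - s'| := by rw [abs_mul, abs_of_nonneg (by linarith)]
  have hnz' : |n * (z - z')| = n * |z - z'| := by rw [abs_mul, abs_of_nonneg (by linarith)]
  have hns'' := abs_le.1 hns'.le
  have hnz'' := abs_le.1 hnz'.le
  have hP : |2 * α * s + 2 * (s - s₀) + 2 * (s - s₀) + 2 * n * (s - s')| ≤
      8 + 2 * (n * |s - s'|) := abs_le.2 ⟨by linarith, by linarith⟩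
  have hQ : |2 * α * z + 2 * (z - z₀) + 2 * (z - z₀) + 2 * n * (z - z')| ≤
      8 + 2 * (n * |z - z'|) := abs_le.2 ⟨by linarith, by linarith⟩
  have hX : 0 ≤ |s - s'| + |z - z'| := by positivity
  have hKX := mul_le_mul_of_nonneg_right (add_le_add hP hQ) (mul_nonneg hK hX)
  have hr2 : r ^ 2 ≤ r := by nlinarith only [hr, hr1]
  have hKX' := mul_le_mul_of_nonneg_left
    (by linarith only [hs, hz, hns, hr2] : 16 * (|s - s'| + |z - z'|) + 2 * (n * (|s - s'| + |z - z'|)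
      * (|s - s'| + |z - z'|)) ≤ 36 * r) hK
  have hMd := mul_le_mul_of_nonneg_right (add_le_add hd1 hd2) (by linarith : 0 ≤ D.M)
  have hl := mul_le_mul_of_nonneg_left hval D.lam_pos.le
  linarith only [hl, hMd, hKX', hKX, hest, hc]

/-- Near the interface, the subsolution inequality bounds the normal slope. -/
theorem Dynamics.abs_slope_le (D : Dynamics ι A) {i : ι} {s z P Q l : ℝ} (hz : 0 ≤ z)
    (hKz : D.K * z ≤ D.δ / 2) (hl : |l| ≤ D.M)
    (h : ∀ a ∈ D.ctrl i,
      D.lam * l - P * D.b₀ i s z a - Q * D.b₁ i s z a - D.cost i s z a ≤ 0) :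
    |Q| * (D.δ / 2) ≤ D.lam * D.M + D.M + |P| * D.M := by
  have hδ := D.δ_pos
  have hll := abs_le.1 (abs_mul_le_of_le (abs_of_pos D.lam_pos).le hl)
  have hlip : ∀ a ∈ D.ctrl i, |D.b₁ i s z a - D.b₁ i s 0 a| ≤ D.δ / 2 := fun a ha => by
    have := D.b₁_lip i s z s 0 a ha
    rw [sub_self, abs_zero, zero_add, sub_zero, abs_of_nonneg hz] at this
    linarith
  have hbd : ∀ a ∈ D.ctrl i, -(Q * D.b₁ i s z a) ≤ D.lam * D.M + D.M + |P| * D.M :=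
    fun a ha => by
      have h1 := abs_le.1 (abs_mul_le_of_le (le_refl |P|) (D.abs_b₀_le i s z a ha))
      have h2 := abs_le.1 (D.abs_cost_le i s z a ha)
      linarith [h a ha]
  rcases le_total 0 Q with hQ | hQ
  · obtain ⟨a, ha, hb⟩ := D.outward i s
    have h1 := abs_le.1 (hlip a ha)
    have h2 := mul_le_mul_of_nonneg_left (by linarith : D.δ / 2 ≤ -D.b₁ i s z a) hQ
    rw [abs_of_nonneg hQ]
    linarith [hbd a ha]
  · obtain ⟨a, ha, hb⟩ := D.inward i s
    have h1 := abs_le.1 (hlip a ha)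
    have h2 := mul_le_mul_of_nonneg_left (by linarith : D.δ / 2 ≤ D.b₁ i s z a)
      (neg_nonneg.2 hQ)
    rw [abs_of_nonpos hQ]
    linarith [hbd a ha]

set_option maxHeartbeats 1000000 in
/-- The comparison estimate near the interface, when the tangential doubling has its maximum
off the interface. -/
theorem estimate_off_interface (hU : IsSub D U) (hV : IsSuper D V) {i : ι}
    {α β μ s₀ x y w n r R ε : ℝ} (hα : 0 < α) (hα1 : α ≤ 1) (hβ1 : β ≤ 1) (hs₀β : α * |s₀| ≤ β)
    (hw : 0 < w) (hwr : w < r) (hx : |x - s₀| < r) (hn : 1 ≤ n) (hpen : n * (x - y) ^ 2 < r ^ 2)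
    (hr : r < 1 / 8) (hKr : D.K * (2 * r) ≤ D.δ / 2) (hrR : 4 * r < R)
    (hcost : ∀ s z, |s - s₀| < R → |z| < R → ∀ a ∈ D.ctrl i,
      |D.cost i s z a - D.cost i s₀ 0 a| < ε)
    (hμ : μ ≤ U i x w - V i y w - α * (x ^ 2 + w ^ 2) - (x - s₀) ^ 2 - w ^ 2 - n * (x - y) ^ 2)
    (hmax : ∀ t₁ t₂ z, |t₁ - s₀| ≤ 1 → |t₂ - s₀| ≤ 1 → 0 ≤ z → z ≤ 1 →
      U i t₁ z - V i t₂ z - α * (t₁ ^ 2 + z ^ 2) - (t₁ - s₀) ^ 2 - z ^ 2 - n * (t₁ - t₂) ^ 2 ≤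
      U i x w - V i y w - α * (x ^ 2 + w ^ 2) - (x - s₀) ^ 2 - w ^ 2 - n * (x - y) ^ 2) :
    D.lam * μ ≤ 4 * D.M * β + 2 * ε +
      (22 * D.M + D.K * (76 + 2 / D.δ * (4 * D.lam * D.M + 80 * D.M))) * r := by
  have hM := D.one_le_M
  have hK := D.K_nonneg
  have hδ := D.δ_pos
  have hlam := D.lam_pos
  have hr0 : 0 < r := hw.trans hwr
  have hxy : |x - y| < r := abs_lt_of_sq_lt_sq (by
    nlinarith only [sq_nonneg (x - y), hn, hpen]) hr0.le
  obtain ⟨θ, hθ, hnθ, hθw, hθ1⟩ : ∃ θ > 0, n * θ ≤ r ∧ θ ≤ w / 4 ∧ θ ≤ 1 / 32 := by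
    refine ⟨min (r / n) (min (w / 4) (1 / 32)), by positivity, ?_, ?_, ?_⟩
    · rw [mul_comm, ← le_div_iff₀ (by linarith)]; exact min_le_left _ _
    · exact (min_le_right _ _).trans (min_le_left _ _)
    · exact (min_le_right _ _).trans (min_le_right _ _)
  have hθr : θ ≤ r := by nlinarith only [hnθ, hn, hθ]
  have hcpt : IsCompact (Icc (x - 1 / 8) (x + 1 / 8) ×ˢ Icc (w / 4) (w + 1 / 8) ×ˢ
      Icc (y - 1 / 8) (y + 1 / 8) ×ˢ Icc (w / 4) (w + 1 / 8)) :=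
    isCompact_Icc.prod (isCompact_Icc.prod (isCompact_Icc.prod isCompact_Icc))
  have husc : UpperSemicontinuous fun p : ℝ × ℝ × ℝ × ℝ => U i p.1 p.2.1
      + -V i p.2.2.1 p.2.2.2 + -(α * (p.1 ^ 2 + p.2.1 ^ 2) + (p.1 - s₀) ^ 2 + p.2.1 ^ 2
        + (p.1 - x) ^ 2 + (p.2.2.1 - y) ^ 2 + (p.2.1 - w) ^ 2 + n * (p.1 - p.2.2.1) ^ 2) :=
    (((hU.usc i).comp (by fun_prop : Continuous fun p : ℝ × ℝ × ℝ × ℝ => (p.1, p.2.1))).add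
      ((hV.neg_usc i).comp (by fun_prop : Continuous fun p : ℝ × ℝ × ℝ × ℝ => p.2.2))).add
      (by fun_prop : Continuous fun p : ℝ × ℝ × ℝ × ℝ => -(α * (p.1 ^ 2 + p.2.1 ^ 2)
        + (p.1 - s₀) ^ 2 + p.2.1 ^ 2 + (p.1 - x) ^ 2 + (p.2.2.1 - y) ^ 2 + (p.2.1 - w) ^ 2
        + n * (p.1 - p.2.2.1) ^ 2)).upperSemicontinuous
  have hx' := abs_lt.1 hx
  have hxy' := abs_lt.1 hxy
  have hmem₀ : (x, w, y, w) ∈ Icc (x - 1 / 8) (x + 1 / 8) ×ˢ Icc (w / 4) (w + 1 / 8) ×ˢ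
      Icc (y - 1 / 8) (y + 1 / 8) ×ˢ Icc (w / 4) (w + 1 / 8) := by
    simp only [mem_prod, mem_Icc]
    refine ⟨⟨?_, ?_⟩, ⟨?_, ?_⟩, ⟨?_, ?_⟩, ?_, ?_⟩ <;> linarith only [hw]
  obtain ⟨m, hm, ⟨s, z, s', z'⟩, hmem, hw', hpen', hdist⟩ := exists_maximizer_penalized hcpt husc
    (g := fun p => (p.2.1 - p.2.2.2) ^ 2)
    (d := fun p => (p.1 - x) ^ 2 + (p.2.2.1 - y) ^ 2 + (p.2.1 - w) ^ 2) (by fun_prop)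
    (by fun_prop) (fun p => by positivity) (fun p => by positivity) hmem₀
    (by simp) (by
      rintro ⟨s, z, s', z'⟩ hmem h0
      simp only [mem_prod, mem_Icc] at hmem
      simp only at h0
      obtain rfl : z' = z := by nlinarith only [h0]
      have := hmax s s' z' (abs_le.2 ⟨by linarith, by linarith⟩)
        (abs_le.2 ⟨by linarith, by linarith⟩) (by linarith) (by linarith)
      simp only [sub_self]
      linarith) (pow_pos hθ 2)
  have hw0 := hw' (x, w, y, w) hmem₀
  simp only at hw' hpen' hdist hw0
  have hsx : |s - x| < θ := abs_lt_of_sq_lt_sq (by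
    linarith only [hdist, sq_nonneg (z - w), sq_nonneg (s' - y)]) hθ.le
  have hsy : |s' - y| < θ := abs_lt_of_sq_lt_sq (by
    linarith only [hdist, sq_nonneg (z - w), sq_nonneg (s - x)]) hθ.le
  have hzw : |z - w| < θ := abs_lt_of_sq_lt_sq (by
    linarith only [hdist, sq_nonneg (s' - y), sq_nonneg (s - x)]) hθ.le
  have hzz : |z - z'| < θ := abs_lt_of_sq_lt_sq (by
    nlinarith only [sq_nonneg (z - z'), hm, hpen']) hθ.le
  have hsx' := abs_lt.1 hsx
  have hsy' := abs_lt.1 hsy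
  have hzw' := abs_lt.1 hzw
  have hzz' := abs_lt.1 hzz
  have hval : μ ≤ U i s z - V i s' z' := by
    have h1 : 0 ≤ α * (s ^ 2 + z ^ 2) := by positivity
    have h2 : 0 ≤ n * (s - s') ^ 2 := by positivity
    have h3 : 0 ≤ m * (z - z') ^ 2 := by positivity
    linarith only [hw0, hμ, h1, h2, h3, sq_nonneg (s - s₀), sq_nonneg z, sq_nonneg (z - w),
      sq_nonneg (s' - y), sq_nonneg (s - x)]
  obtain ⟨hsub, a, ha, hsup⟩ := doubling_interior hU hV (i := i) (α := α) (s₀ := s₀) (z₀ := 0)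
    (x := x) (y := y) (w := w) (n := n) (m := m) (s := s) (z := z) (s' := s') (z' := z')
    (by linarith) (by linarith) ⟨min (w / 8) (1 / 32), by positivity,
      fun t₁ y₁ t₂ y₂ h₁ h₂ h₃ h₄ => by
      rw [lt_min_iff, abs_lt, abs_lt] at h₁ h₂ h₃ h₄
      have := hw' (t₁, y₁, t₂, y₂) (by
        simp only [mem_prod, mem_Icc]
        refine ⟨⟨?_, ?_⟩, ⟨?_, ?_⟩, ⟨?_, ?_⟩, ?_, ?_⟩ <;> linarith)
      simp only at this
      linarith⟩
  have hest := D.sub_le_of_slopes ha (hsub a ha) hsup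
  have hslope := D.abs_slope_le (by linarith)
    ((mul_le_mul_of_nonneg_left (by linarith) hK).trans hKr) (hU.bounded i s z) hsub
  have hc1 := abs_lt.1 (hcost s z (abs_lt.2 ⟨by linarith, by linarith⟩)
    (abs_lt.2 ⟨by linarith, by linarith⟩) a ha)
  have hc2 := abs_lt.1 (hcost s' z' (abs_lt.2 ⟨by linarith, by linarith⟩)
    (abs_lt.2 ⟨by linarith, by linarith⟩) a ha)
  clear hw' hw0 hsub hsup hmax husc hcpt hpen' hdist hcost hmem hmem₀
  have hc : |D.cost i s z a - D.cost i s' z' a| ≤ 2 * ε := abs_le.2 ⟨by linarith, by linarith⟩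
  have hsα : |α * s| ≤ β + 2 * r := by
    rw [abs_mul, abs_of_pos hα]
    have h1 : |s| ≤ |s₀| + 2 * r := by
      have := abs_add_le s₀ ((s - x) + (x - s₀))
      rw [sub_add_sub_cancel, add_sub_cancel] at this
      have h2 := abs_sub_le s x s₀
      linarith
    have h2 := mul_le_mul_of_nonneg_left h1 hα.le
    have h3 := mul_le_mul_of_nonneg_right hα1 hr0.le
    linarith
  have hzα : |α * z| ≤ 2 * r := by
    rw [abs_of_nonneg (mul_nonneg hα.le (by linarith))]
    have h2 := mul_le_mul_of_nonneg_left (by linarith : z ≤ 2 * r) hα.le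
    have h3 := mul_le_mul_of_nonneg_right hα1 hr0.le
    linarith
  rw [abs_le] at hsα hzα
  have hd1 : |2 * α * s + 2 * (s - s₀) + 2 * (s - x) + 2 * n * (s - s')
      - (2 * n * (s - s') - 2 * (s' - y))| ≤ 2 * β + 12 * r :=
    abs_le.2 ⟨by linarith, by linarith⟩
  have hd2 : |2 * α * z + 2 * (z - 0) + 2 * (z - w) + 2 * m * (z - z')
      - 2 * m * (z - z')| ≤ 10 * r :=
    abs_le.2 ⟨by linarith, by linarith⟩
  have hss : |s - s'| ≤ |x - y| + 2 * θ := by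
    have h1 := abs_sub_le s x s'
    have h2 := abs_sub_le x y s'
    rw [abs_sub_comm y s'] at h2
    linarith
  have hnxy : |n * (x - y)| = n * |x - y| := by rw [abs_mul, abs_of_nonneg (by linarith)]
  have hns : |n * (s - s')| ≤ n * |x - y| + 2 * r := by
    rw [abs_mul, abs_of_nonneg (by linarith)]
    have := mul_le_mul_of_nonneg_left hss (by linarith : 0 ≤ n)
    linarith
  rw [abs_le] at hns
  have hP : |2 * α * s + 2 * (s - s₀) + 2 * (s - x) + 2 * n * (s - s')| ≤
      2 * (n * |x - y|) + 17 := abs_le.2 ⟨by linarith, by linarith⟩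
  set P := 2 * α * s + 2 * (s - s₀) + 2 * (s - x) + 2 * n * (s - s')
  set Q := 2 * α * z + 2 * (z - 0) + 2 * (z - w) + 2 * m * (z - z')
  set X := |s - s'| + |z - z'|
  have hX0 : 0 ≤ X := by positivity
  have hX : X ≤ |x - y| + 3 * θ := by simp only [X]; linarith
  have hX4 : X ≤ 4 * r := by linarith
  have hr2 : r ^ 2 ≤ r / 8 := by nlinarith only [hr0, hr]
  have hPX : |P| * X ≤ 76 * r := by
    have h1 := mul_le_mul_of_nonneg_right hP hX0
    have h2 : n * |x - y| * X ≤ n * |x - y| * (|x - y| + 3 * θ) :=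
      mul_le_mul_of_nonneg_left hX (by positivity)
    have h3 : n * |x - y| * |x - y| < r ^ 2 := by
      rwa [mul_assoc, ← pow_two, sq_abs]
    have h4 : n * θ * |x - y| ≤ r * r := mul_le_mul hnθ hxy.le (abs_nonneg _) hr0.le
    linarith only [h1, h2, h3, h4, hX4, hr2, hr0]
  have hQX : |Q| * X ≤ 2 / D.δ * (4 * D.lam * D.M + 80 * D.M) * r := by
    have h1 : |Q| * X * (D.δ / 2) ≤ (4 * D.lam * D.M + 80 * D.M) * r := by
      have h2 := mul_le_mul_of_nonneg_right hslope hX0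
      have h3 := mul_le_mul_of_nonneg_left hX4 (by positivity : 0 ≤ D.lam * D.M + D.M)
      have h4 := mul_le_mul_of_nonneg_right hPX (by positivity : 0 ≤ D.M)
      linarith only [h2, h3, h4]
    calc |Q| * X = 2 / D.δ * (|Q| * X * (D.δ / 2)) := by field_simp
      _ ≤ 2 / D.δ * ((4 * D.lam * D.M + 80 * D.M) * r) :=
          mul_le_mul_of_nonneg_left h1 (by positivity)
      _ = _ := by ring
  have hKX := mul_le_mul_of_nonneg_left (add_le_add hPX hQX) hK
  have hMd := mul_le_mul_of_nonneg_right (add_le_add hd1 hd2) (by linarith : 0 ≤ D.M)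
  have hl := mul_le_mul_of_nonneg_left hval D.lam_pos.le
  have hβ0 : 0 ≤ D.M * β := mul_nonneg (by linarith) (le_trans (by positivity) hs₀β)
  linarith only [hl, hMd, hKX, hest, hc, hβ0]

/-- The largest normal slope compatible with the inward controls, up to an error `r`. -/
theorem Dynamics.exists_slope (D : Dynamics ι A) {j : ι} {x P R l r : ℝ} (hr : 0 < r)
    (hl : |l| ≤ D.M) (hR : D.lam * D.M + D.M + |P| * D.M ≤ R * D.δ)
    (h : ∀ a ∈ D.ctrl j, 0 ≤ D.b₁ j x 0 a →
      D.lam * l - P * D.b₀ j x 0 a - R * D.b₁ j x 0 a - D.cost j x 0 a ≤ 0) :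
    ∃ p, |p + r| ≤ R ∧
      (∀ a ∈ D.ctrl j, 0 < D.b₁ j x 0 a →
        D.lam * l - P * D.b₀ j x 0 a - D.cost j x 0 a ≤ (p + r) * D.b₁ j x 0 a) ∧
      ∃ a ∈ D.ctrl j, 0 < D.b₁ j x 0 a ∧
        p * D.b₁ j x 0 a < D.lam * l - P * D.b₀ j x 0 a - D.cost j x 0 a := by
  have hδ := D.δ_pos
  set S := (fun a => (D.lam * l - P * D.b₀ j x 0 a - D.cost j x 0 a) / D.b₁ j x 0 a) ''
    {a | a ∈ D.ctrl j ∧ 0 < D.b₁ j x 0 a} with hS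
  have hub : ∀ σ ∈ S, σ ≤ R := by
    rintro _ ⟨a, ⟨ha, hb⟩, rfl⟩
    rw [div_le_iff₀ hb]
    linarith [h a ha hb.le]
  obtain ⟨a₁, ha₁, hb₁⟩ := D.inward j x
  have hmem : (D.lam * l - P * D.b₀ j x 0 a₁ - D.cost j x 0 a₁) / D.b₁ j x 0 a₁ ∈ S :=
    ⟨a₁, ⟨ha₁, by rw [hb₁]; exact hδ⟩, rfl⟩
  have hbdd : BddAbove S := ⟨R, hub⟩
  have hlow : -R ≤ sSup S := by
    refine le_trans ?_ (le_csSup hbdd hmem)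
    rw [hb₁, le_div_iff₀ hδ]
    have h1 := abs_le.1 (abs_mul_le_of_le (le_refl |P|) (D.abs_b₀_le j x 0 a₁ ha₁))
    have h2 := abs_le.1 (D.abs_cost_le j x 0 a₁ ha₁)
    have h3 := abs_le.1 (abs_mul_le_of_le (abs_of_pos D.lam_pos).le hl)
    linarith
  refine ⟨sSup S - r, ?_, fun a ha hb => ?_, ?_⟩
  · rw [sub_add_cancel]
    exact abs_le.2 ⟨hlow, csSup_le ⟨_, hmem⟩ hub⟩
  · rw [sub_add_cancel, ← div_le_iff₀ hb]
    exact le_csSup hbdd ⟨a, ⟨ha, hb⟩, rfl⟩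
  · obtain ⟨_, ⟨a, ⟨ha, hb⟩, rfl⟩, hlt⟩ := exists_lt_of_lt_csSup ⟨_, hmem⟩
      (by linarith : sSup S - r < sSup S)
    exact ⟨a, ha, hb, (lt_div_iff₀ hb).1 hlt⟩

/-- The slope bound extends to nearly inward controls. -/
theorem Dynamics.slope_le_of_nearly_inward (D : Dynamics ι A) {j : ι} {x P p R l η τ : ℝ}
    (hl : |l| ≤ D.M) (hp : |p| ≤ R)
    (h : ∀ a ∈ D.ctrl j, 0 < D.b₁ j x 0 a →
      D.lam * l - P * D.b₀ j x 0 a - D.cost j x 0 a ≤ p * D.b₁ j x 0 a)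
    {a : A} (ha : a ∈ D.ctrl j) (hη : 0 ≤ η) (hb : -η ≤ D.b₁ j x 0 a) (hτ : η < τ * D.δ)
    (hτ1 : τ ≤ 1 / 2) :
    D.lam * l - P * D.b₀ j x 0 a - p * D.b₁ j x 0 a - D.cost j x 0 a ≤
      2 * τ * (D.δ * R + D.lam * D.M + D.M + |P| * D.M) := by
  have hδ := D.δ_pos
  have hM := D.one_le_M
  have hlam := D.lam_pos
  have hR : 0 ≤ R := (abs_nonneg p).trans hp
  have hτ0 : 0 < τ := pos_of_mul_pos_left (hη.trans_lt hτ) hδ.le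
  obtain ⟨a₁, ha₁, hb₁⟩ := D.inward j x
  obtain ⟨a₂, ha₂, h0, h1, hc⟩ := D.mix j x a ha a₁ ha₁ τ hτ0.le (by linarith)
  have hpos : 0 < D.b₁ j x 0 a₂ := by
    rw [h1, hb₁]
    have h2 := mul_le_mul_of_nonneg_left hb (by linarith : 0 ≤ 1 - τ)
    have h3 := mul_nonneg hτ0.le hη
    linarith
  have h2 := h a₂ ha₂ hpos
  rw [h0, h1, hc, hb₁] at h2
  have h3 := abs_le.1 (abs_mul_le_of_le (le_refl |P|) (D.abs_b₀_le j x 0 a₁ ha₁))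
  have h4 := abs_le.1 (D.abs_cost_le j x 0 a₁ ha₁)
  have h5 := abs_le.1 (abs_mul_le_of_le (abs_of_pos hlam).le hl)
  have h6 := mul_le_mul_of_nonneg_left ((le_abs_self p).trans hp) hδ.le
  have h7 : τ * (p * D.δ - (D.lam * l - P * D.b₀ j x 0 a₁ - D.cost j x 0 a₁)) ≤
      τ * (D.δ * R + D.lam * D.M + D.M + |P| * D.M) :=
    mul_le_mul_of_nonneg_left (by linarith) hτ0.le
  have h8 : 0 ≤ τ * (D.δ * R + D.lam * D.M + D.M + |P| * D.M) := by positivity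
  by_contra! hcon
  have h9 := mul_lt_mul_of_pos_left hcon (by linarith : 0 < 1 - τ)
  have h10 := mul_le_mul_of_nonneg_left hτ1 h8
  linarith

set_option maxHeartbeats 1000000 in
/-- At a maximum of the tangential doubling on the interface, inward trajectories of the
subsolution bound the supersolution from below. -/
theorem IsSub.lower_bound (hU : IsSub D U) {j : ι} {α s₀ x y n p : ℝ} (hα : 0 ≤ α) (hn : 0 ≤ n)
    (hmax : ∀ t₁ t₂ z, |t₁ - x| ≤ 1 / 2 → |t₂ - y| ≤ 1 / 2 → 0 ≤ z → z ≤ 1 →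
      U j t₁ z - V j t₂ z - α * (t₁ ^ 2 + z ^ 2) - (t₁ - s₀) ^ 2 - z ^ 2 - n * (t₁ - t₂) ^ 2 ≤
      U j x 0 - V j y 0 - α * x ^ 2 - (x - s₀) ^ 2 - n * (x - y) ^ 2)
    {a : A} (ha : a ∈ D.ctrl j) (hb : 0 < D.b₁ j x 0 a)
    (hp : p * D.b₁ j x 0 a < D.lam * U j x 0
      - (2 * α * x + 2 * (x - s₀) + 2 * n * (x - y)) * D.b₀ j x 0 a - D.cost j x 0 a) :
    ∃ B, ∃ ρ > 0, ∀ t z, |t - y| < ρ → 0 ≤ z → z < ρ →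
      V j y 0 + 2 * n * (x - y) * (t - y) + p * z + -(2 * n) * (t - y) ^ 2 + B * z ^ 2
        ≤ V j t z := by
  set P := 2 * α * x + 2 * (x - s₀) + 2 * n * (x - y) with hP
  obtain ⟨κ, hκ, hκe⟩ : ∃ κ > 0, κ * (1 + |P| * D.b₁ j x 0 a) = D.lam * U j x 0
      - P * D.b₀ j x 0 a - D.cost j x 0 a - p * D.b₁ j x 0 a :=
    ⟨_, div_pos (sub_pos.2 hp) (by positivity), div_mul_cancel₀ _ (by positivity)⟩
  obtain ⟨k, hk⟩ : ∃ k, k * D.b₁ j x 0 a = D.b₀ j x 0 a := ⟨_, div_mul_cancel₀ _ hb.ne'⟩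
  obtain ⟨c, hc⟩ : ∃ c, c * D.b₁ j x 0 a = D.lam * U j x 0 - D.cost j x 0 a - κ :=
    ⟨_, div_mul_cancel₀ _ hb.ne'⟩
  have hcp : c - P * k - |P| * κ = p := by
    refine mul_right_cancel₀ hb.ne' ?_
    linear_combination hc - P * hk - hκe
  have hev := (hU.eventually_inward ha hb hκ hk hc).and
    (eventually_mul_lt (|k| + κ) (by norm_num : (0 : ℝ) < 1 / 2))
  obtain ⟨ρ, hρ, hball⟩ := (mem_nhdsGT_iff_exists_Ioo_subset.1 hev)
  rw [mem_Ioi] at hρ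
  refine ⟨-((α + 1 + 2 * n) * (|k| + κ) ^ 2 + (α + 1)), min ρ (1 / 2), by positivity,
    fun t z ht hz0 hz => ?_⟩
  rw [lt_min_iff] at ht hz
  rcases hz0.lt_or_eq with hz0' | hz0'
  · obtain ⟨⟨t₁, ht₁, hval⟩, hsm⟩ := hball ⟨hz0', hz.1⟩
    obtain ⟨τ, rfl⟩ : ∃ τ, t₁ = x + τ := ⟨t₁ - x, by ring⟩
    obtain ⟨h, rfl⟩ : ∃ h, t = y + h := ⟨t - y, by ring⟩
    rw [add_sub_cancel_left] at ht₁ ht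
    have hkz : |k * z| ≤ |k| * z := by rw [abs_mul, abs_of_pos hz0']
    have hτ : |τ| ≤ (|k| + κ) * z := by
      have := abs_add_le (τ - k * z) (k * z)
      rw [sub_add_cancel] at this
      linarith
    have hPτ := (abs_le.1 (abs_mul_le_of_le (le_refl |P|) ht₁)).2
    have hτ2 : τ ^ 2 ≤ (|k| + κ) ^ 2 * z ^ 2 := by
      rw [← mul_pow, ← sq_abs]; exact pow_le_pow_left₀ (abs_nonneg _) hτ 2
    have h1 := hmax (x + τ) (y + h) z (by rw [add_sub_cancel_left]; linarith)
      (by rw [add_sub_cancel_left]; linarith) hz0 (by linarith)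
    have h2 := mul_le_mul_of_nonneg_left hτ2 (by positivity : 0 ≤ α + 1 + 2 * n)
    have h3 : (c - P * k - |P| * κ) * z = p * z := by rw [hcp]
    have h4 := mul_nonneg hn (sq_nonneg (τ + h))
    rw [add_sub_cancel_left]
    rw [hP] at hPτ h3
    clear hball hmax hcp hκe hp
    linarith only [h1, h2, h3, h4, hPτ, hval]
  · subst hz0'
    have h1 := hmax x t 0 (by simp) (by linarith) le_rfl zero_le_one
    have h2 := mul_nonneg hn (sq_nonneg (t - y))
    linarith

set_option maxHeartbeats 1000000 in
/-- The comparison estimate near the interface, when the tangential doubling has its maximum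
on the interface. -/
theorem estimate_on_interface (hU : IsSub D U) (hV : IsSuper D V) {i : ι}
    {α β μ s₀ x y n r R ε C : ℝ} (hα : 0 < α) (hα1 : α ≤ 1) (hβ1 : β ≤ 1) (hs₀β : α * |s₀| ≤ β)
    (hr0 : 0 < r) (hx : |x - s₀| < r) (hn : 1 ≤ n) (hpen : n * (x - y) ^ 2 < r ^ 2)
    (hr : r < 1 / 8) (hrτ : (5 * D.K + 2) / D.δ * r ≤ 1 / 2) (hrR : 4 * r < R)
    (hcost : ∀ j s, |s - s₀| < R → ∀ a ∈ D.ctrl j, |D.cost j s 0 a - D.cost j s₀ 0 a| < ε)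
    (hμ : μ ≤ U i x 0 - V i y 0 - α * x ^ 2 - (x - s₀) ^ 2 - n * (x - y) ^ 2)
    (hmax : ∀ j t₁ t₂ z, |t₁ - s₀| ≤ 1 → |t₂ - s₀| ≤ 1 → 0 ≤ z → z ≤ 1 →
      U j t₁ z - V j t₂ z - α * (t₁ ^ 2 + z ^ 2) - (t₁ - s₀) ^ 2 - z ^ 2 - n * (t₁ - t₂) ^ 2 ≤
      U i x 0 - V i y 0 - α * x ^ 2 - (x - s₀) ^ 2 - n * (x - y) ^ 2)
    (hC : C = 2 / D.δ * (D.lam * D.M + 3 * D.M)) :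
    D.lam * μ ≤ 4 * D.M * β + 2 * ε + (5 * D.M + 5 * D.K * (1 + C)
      + 2 * ((5 * D.K + 2) / D.δ) * (D.δ * C + D.lam * D.M + D.M)) * r := by
  have hM := D.one_le_M
  have hK := D.K_nonneg
  have hδ := D.δ_pos
  have hlam := D.lam_pos
  have hC0 : 0 ≤ C := by rw [hC]; positivity
  have hCδ : C * D.δ = 2 * (D.lam * D.M + 3 * D.M) := by rw [hC]; field_simp
  have hxy : |x - y| < r := abs_lt_of_sq_lt_sq (by
    nlinarith only [sq_nonneg (x - y), hn, hpen]) hr0.le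
  have hx' := abs_lt.1 hx
  have hxy' := abs_lt.1 hxy
  set P := 2 * α * x + 2 * (x - s₀) + 2 * n * (x - y) with hP
  have hxα : |α * x| ≤ β + r := by
    rw [abs_mul, abs_of_pos hα]
    have h1 : |x| ≤ |s₀| + r := by
      have := abs_add_le s₀ (x - s₀)
      rw [add_sub_cancel] at this
      linarith
    have h2 := mul_le_mul_of_nonneg_left h1 hα.le
    have h3 := mul_le_mul_of_nonneg_right hα1 hr0.le
    linarith
  have hxα' := abs_le.1 hxα
  have hPq : |P - 2 * n * (x - y)| ≤ 2 * β + 4 * r :=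
    abs_le.2 ⟨by rw [hP]; linarith, by rw [hP]; linarith⟩
  have hnxy : |2 * n * (x - y)| = 2 * (n * |x - y|) := by
    rw [abs_mul, abs_of_nonneg (by linarith)]; ring
  have hPX : (1 + |P|) * |x - y| ≤ 5 * r := by
    have h1 : |P| ≤ 5 / 2 + 2 * (n * |x - y|) := by
      have := abs_add_le (P - 2 * n * (x - y)) (2 * n * (x - y))
      rw [sub_add_cancel, hnxy] at this
      linarith
    have h2 := mul_le_mul_of_nonneg_right h1 (abs_nonneg (x - y))
    have h3 : n * |x - y| * |x - y| < r ^ 2 := by rwa [mul_assoc, ← pow_two, sq_abs]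
    have h4 : r ^ 2 ≤ r / 8 := by nlinarith only [hr0, hr]
    linarith only [h2, h3, h4, hxy, hr0]
  have hP1 : 1 ≤ 1 + |P| := by linarith [abs_nonneg P]
  obtain ⟨R₀, hR₀⟩ : ∃ R₀, R₀ = C * (1 + |P|) := ⟨_, rfl⟩
  have hR₀δ : R₀ * D.δ = 2 * (D.lam * D.M + 3 * D.M) * (1 + |P|) := by
    rw [hR₀, ← hCδ]; ring
  have hlamM : 0 < D.lam * D.M := by positivity
  have hPM : 0 ≤ |P| * D.M := by positivity
  have hPlM : 0 ≤ |P| * (D.lam * D.M) := by positivity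
  have hmax' : ∀ j t₁ t₂ z, |t₁ - x| ≤ 1 / 2 → |t₂ - y| ≤ 1 / 2 → 0 ≤ z → z ≤ 1 →
      U j t₁ z - V j t₂ z - α * (t₁ ^ 2 + z ^ 2) - (t₁ - s₀) ^ 2 - z ^ 2 - n * (t₁ - t₂) ^ 2 ≤
      U j x 0 - V j y 0 - α * x ^ 2 - (x - s₀) ^ 2 - n * (x - y) ^ 2 := by
    intro j t₁ t₂ z h1 h2 h3 h4
    rw [hU.trace j i x, hV.trace j i y]
    rw [abs_le] at h1 h2
    exact hmax j t₁ t₂ z (abs_le.2 ⟨by linarith, by linarith⟩)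
      (abs_le.2 ⟨by linarith, by linarith⟩) h3 h4
  have hsub := hU.interface_le (x := x) (ρ := 1 / 2) (P := P) (Q := α + 1 + n) (R := R₀)
    (by norm_num) (fun j t ht => by
      have := hmax' j t y 0 ht (by simp) le_rfl zero_le_one
      rw [hP]
      linarith) (by linarith)
  have hslope : ∀ j, ∃ p, |p + r| ≤ R₀ ∧
      (∀ a ∈ D.ctrl j, 0 < D.b₁ j x 0 a →
        D.lam * U j x 0 - P * D.b₀ j x 0 a - D.cost j x 0 a ≤ (p + r) * D.b₁ j x 0 a) ∧
      ∃ a ∈ D.ctrl j, 0 < D.b₁ j x 0 a ∧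
        p * D.b₁ j x 0 a < D.lam * U j x 0 - P * D.b₀ j x 0 a - D.cost j x 0 a := fun j =>
    D.exists_slope hr0 (hU.bounded j x 0) (by linarith) (hsub j)
  choose p hpR hple hplt using hslope
  have hlow : ∀ j, ∃ B, ∃ ρ > 0, ∀ t z, |t - y| < ρ → 0 ≤ z → z < ρ →
      V j y 0 + 2 * n * (x - y) * (t - y) + p j * z + -(2 * n) * (t - y) ^ 2 + B * z ^ 2
        ≤ V j t z := fun j => by
    obtain ⟨a, ha, hb, hlt⟩ := hplt j
    exact hU.lower_bound hα.le (by linarith) (hmax' j) ha hb hlt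
  choose B ρ hρ hB using hlow
  obtain ⟨j, a, ha, hb, hsup⟩ := hV.interface y (2 * n * (x - y)) (-(2 * n)) p B
    fun j => ⟨ρ j, hρ j, hB j⟩
  obtain ⟨τ, hτ⟩ : ∃ τ, τ = (D.K * |x - y| + r / (1 + |P|)) / D.δ := ⟨_, rfl⟩
  have hτδ : τ * D.δ = D.K * |x - y| + r / (1 + |P|) := by rw [hτ]; field_simp
  have hτP : τ * (1 + |P|) ≤ (5 * D.K + 2) / D.δ * r := by
    rw [div_mul_eq_mul_div, le_div_iff₀ hδ]
    have h1 : r / (1 + |P|) * (1 + |P|) = r := div_mul_cancel₀ _ (by positivity)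
    have h2 := mul_le_mul_of_nonneg_left hPX hK
    calc τ * (1 + |P|) * D.δ = τ * D.δ * (1 + |P|) := by ring
      _ = D.K * ((1 + |P|) * |x - y|) + r / (1 + |P|) * (1 + |P|) := by rw [hτδ]; ring
      _ ≤ _ := by rw [h1]; linarith
  have hτ0 : 0 ≤ τ := by rw [hτ]; positivity
  have hτ1 : τ ≤ 1 / 2 := by
    have := mul_le_mul_of_nonneg_left hP1 hτ0
    linarith
  have hbx : -(D.K * |x - y|) ≤ D.b₁ j x 0 a := by
    have := abs_le.1 (D.b₁_lip j x 0 y 0 a ha)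
    simp only [sub_self, abs_zero, add_zero] at this
    linarith
  have hnear := D.slope_le_of_nearly_inward (hU.bounded j x 0) (hpR j) (hple j) ha
    (by positivity) hbx (by rw [hτδ]; linarith [div_pos hr0 (by linarith : 0 < 1 + |P|)]) hτ1
  obtain ⟨E, hE⟩ : ∃ E, E = 2 * τ * (D.δ * R₀ + D.lam * D.M + D.M + |P| * D.M) := ⟨_, rfl⟩
  rw [← hE] at hnear
  have hEle : E ≤ 2 * ((5 * D.K + 2) / D.δ) * (D.δ * C + D.lam * D.M + D.M) * r := by
    have h1 : D.δ * R₀ + D.lam * D.M + D.M + |P| * D.M ≤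
        (1 + |P|) * (D.δ * C + D.lam * D.M + D.M) := by
      rw [hR₀]; linarith
    have h2 := mul_le_mul_of_nonneg_left h1 hτ0
    have h3 := mul_le_mul_of_nonneg_right hτP
      (by positivity : 0 ≤ D.δ * C + D.lam * D.M + D.M)
    rw [hE]
    linarith
  have hest := D.sub_le_of_slopes ha (l := D.lam * U j x 0 - E) (l' := D.lam * V j y 0)
    (P := P) (Q := p j + r) (by linarith) hsup
  have hc1 := abs_lt.1 (hcost j x (by linarith) a ha)
  have hc2 := abs_lt.1 (hcost j y (abs_lt.2 ⟨by linarith, by linarith⟩) a ha)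
  have hc : |D.cost j x 0 a - D.cost j y 0 a| ≤ 2 * ε := abs_le.2 ⟨by linarith, by linarith⟩
  rw [sub_self, abs_zero, add_zero, add_sub_cancel_left, abs_of_pos hr0] at hest
  have hKX : (|P| + |p j + r|) * (D.K * |x - y|) ≤ 5 * D.K * (1 + C) * r := by
    have h1 : |P| + |p j + r| ≤ (1 + C) * (1 + |P|) := by rw [hR₀] at hpR; linarith [hpR j]
    have h2 := mul_le_mul_of_nonneg_right h1 (by positivity : 0 ≤ D.K * |x - y|)
    have h3 := mul_le_mul_of_nonneg_left hPX (by positivity : 0 ≤ (1 + C) * D.K)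
    linarith
  have hval : μ ≤ U j x 0 - V j y 0 := by
    rw [hU.trace j i x, hV.trace j i y]
    have h1 : 0 ≤ α * x ^ 2 := by positivity
    have h2 : 0 ≤ n * (x - y) ^ 2 := by positivity
    linarith [sq_nonneg (x - s₀)]
  have hl := mul_le_mul_of_nonneg_left hval hlam.le
  have hMd := mul_le_mul_of_nonneg_right hPq (by linarith : 0 ≤ D.M)
  have hβ0 : 0 ≤ D.M * β := mul_nonneg (by linarith) (le_trans (by positivity) hs₀β)
  linarith only [hl, hMd, hKX, hest, hc, hEle, hβ0]

theorem upperSemicontinuous_prod_of_discrete {X Y : Type*} [TopologicalSpace X]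
    [DiscreteTopology X] [TopologicalSpace Y] {f : X × Y → ℝ}
    (h : ∀ x, UpperSemicontinuous fun y => f (x, y)) : UpperSemicontinuous f := by
  rintro ⟨x, y⟩ c hc
  rw [nhds_prod_eq, nhds_discrete, Filter.pure_prod, Filter.eventually_map]
  exact h x y c hc

set_option maxHeartbeats 1000000 in
/-- The comparison estimate at a maximum point on the interface. -/
theorem estimate_interface [Finite ι] (hU : IsSub D U) (hV : IsSuper D V) {i : ι}
    {α β μ s₀ : ℝ} (hα : 0 < α) (hα1 : α ≤ 1) (hβ1 : β ≤ 1) (hs₀β : α * |s₀| ≤ β)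
    (hμ : μ ≤ U i s₀ 0 - V i s₀ 0 - α * s₀ ^ 2)
    (hmax : ∀ j s z, 0 ≤ z → U j s z - V j s z - α * (s ^ 2 + z ^ 2) ≤
      U i s₀ 0 - V i s₀ 0 - α * s₀ ^ 2) :
    D.lam * μ ≤ 4 * D.M * β := by
  have hM := D.one_le_M
  have hK := D.K_nonneg
  have hδ := D.δ_pos
  have hlam := D.lam_pos
  refine le_of_forall_pos_le_add fun ε hε => ?_
  obtain ⟨R, hR, hcost⟩ : ∃ R > 0, ∀ j s z, |s - s₀| < R → |z| < R → ∀ a ∈ D.ctrl j,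
      |D.cost j s z a - D.cost j s₀ 0 a| < ε / 2 := by
    choose R hR h using fun j => D.cost_equicont j s₀ 0 (ε / 2) (by positivity)
    have : Nonempty ι := ⟨i⟩
    obtain ⟨j₀, hj₀⟩ := Finite.exists_min R
    exact ⟨R j₀, hR j₀, fun j s z hs hz => h j s z (hs.trans_le (hj₀ j))
      (by rw [sub_zero]; exact hz.trans_le (hj₀ j))⟩
  obtain ⟨C, hC⟩ : ∃ C, C = 2 / D.δ * (D.lam * D.M + 3 * D.M) := ⟨_, rfl⟩
  obtain ⟨C₁, hC₁⟩ : ∃ C₁, C₁ = 22 * D.M + D.K * (76 + 2 / D.δ * (4 * D.lam * D.M + 80 * D.M)) :=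
    ⟨_, rfl⟩
  obtain ⟨C₂, hC₂⟩ : ∃ C₂, C₂ = 5 * D.M + 5 * D.K * (1 + C)
      + 2 * ((5 * D.K + 2) / D.δ) * (D.δ * C + D.lam * D.M + D.M) := ⟨_, rfl⟩
  have hC0 : 0 ≤ C := by rw [hC]; positivity
  have hC₁0 : 0 ≤ C₁ := by rw [hC₁]; positivity
  have hC₂0 : 0 ≤ C₂ := by rw [hC₂]; positivity
  refine le_of_forall_small (C := C₁ + C₂)
    ⟨min (min (R / 4) (1 / 8)) (min (D.δ / (4 * D.K + 1)) (D.δ / (2 * (5 * D.K + 2)))),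
      by positivity, fun r hr hrρ => ?_⟩
  obtain ⟨⟨hrR, hr1⟩, hrK, hrτ⟩ : (r < R / 4 ∧ r < 1 / 8) ∧ r < D.δ / (4 * D.K + 1) ∧
      r < D.δ / (2 * (5 * D.K + 2)) := by simpa only [lt_min_iff] using hrρ
  rw [lt_div_iff₀ (by positivity)] at hrK hrτ
  let _ : TopologicalSpace ι := ⊥
  have _ : DiscreteTopology ι := ⟨rfl⟩
  have hcpt : IsCompact ((univ : Set ι) ×ˢ Icc (s₀ - 1) (s₀ + 1) ×ˢ Icc (s₀ - 1) (s₀ + 1) ×ˢ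
      Icc (0 : ℝ) 1) :=
    isCompact_univ.prod (isCompact_Icc.prod (isCompact_Icc.prod isCompact_Icc))
  have husc : UpperSemicontinuous fun p : ι × ℝ × ℝ × ℝ => U p.1 p.2.1 p.2.2.2
      + -V p.1 p.2.2.1 p.2.2.2
      + -(α * (p.2.1 ^ 2 + p.2.2.2 ^ 2) + (p.2.1 - s₀) ^ 2 + p.2.2.2 ^ 2) :=
    upperSemicontinuous_prod_of_discrete fun j =>
      (((hU.usc j).comp (by fun_prop : Continuous fun p : ℝ × ℝ × ℝ => (p.1, p.2.2))).add
      ((hV.neg_usc j).comp (by fun_prop : Continuous fun p : ℝ × ℝ × ℝ => p.2))).add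
      (by fun_prop : Continuous fun p : ℝ × ℝ × ℝ => -(α * (p.1 ^ 2 + p.2.2 ^ 2)
        + (p.1 - s₀) ^ 2 + p.2.2 ^ 2)).upperSemicontinuous
  have hmem₀ : (i, s₀, s₀, (0 : ℝ)) ∈ (univ : Set ι) ×ˢ Icc (s₀ - 1) (s₀ + 1) ×ˢ
      Icc (s₀ - 1) (s₀ + 1) ×ˢ Icc (0 : ℝ) 1 := by
    simp
  obtain ⟨n, hn, ⟨j, x, y, w⟩, hmem, hw, hpen, hdist⟩ := exists_maximizer_penalized hcpt husc
    (g := fun p => (p.2.1 - p.2.2.1) ^ 2)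
    (d := fun p => (p.2.1 - s₀) ^ 2 + p.2.2.2 ^ 2) (by fun_prop)
    (by fun_prop) (fun p => by positivity) (fun p => by positivity) hmem₀
    (by simp) (by
      rintro ⟨j, s, s', z⟩ hmem h0
      simp only [mem_prod, mem_Icc] at hmem
      simp only at h0
      obtain rfl : s' = s := by nlinarith only [h0]
      have := hmax j s' z (by linarith)
      simp only [sub_self]
      linarith) (pow_pos hr 2)
  have hw0 := hw _ hmem₀
  simp only [mem_prod, mem_Icc, mem_univ, true_and] at hmem
  simp only at hw hpen hdist hw0
  have hx : |x - s₀| < r := abs_lt_of_sq_lt_sq (by linarith only [hdist, sq_nonneg w]) hr.le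
  have hwr : w < r := lt_of_abs_lt (abs_lt_of_sq_lt_sq
    (by linarith only [hdist, sq_nonneg (x - s₀)]) hr.le)
  have hmax' : ∀ j' t₁ t₂ z, |t₁ - s₀| ≤ 1 → |t₂ - s₀| ≤ 1 → 0 ≤ z → z ≤ 1 →
      U j' t₁ z - V j' t₂ z - α * (t₁ ^ 2 + z ^ 2) - (t₁ - s₀) ^ 2 - z ^ 2 - n * (t₁ - t₂) ^ 2 ≤
      U j x w - V j y w - α * (x ^ 2 + w ^ 2) - (x - s₀) ^ 2 - w ^ 2 - n * (x - y) ^ 2 := by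
    intro j' t₁ t₂ z h1 h2 h3 h4
    rw [abs_le] at h1 h2
    have := hw (j', t₁, t₂, z) (by
      simp only [mem_prod, mem_Icc, mem_univ, true_and]
      refine ⟨⟨?_, ?_⟩, ⟨?_, ?_⟩, ?_, ?_⟩ <;> linarith)
    simp only at this
    linarith
  have hμ' : μ ≤ U j x w - V j y w - α * (x ^ 2 + w ^ 2) - (x - s₀) ^ 2 - w ^ 2
      - n * (x - y) ^ 2 := by linarith
  have h1r := mul_nonneg hC₁0 hr.le
  have h2r := mul_nonneg hC₂0 hr.le
  rcases hmem.2.2.1.lt_or_eq with hw1 | hw1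
  · have := estimate_off_interface hU hV hα hα1 hβ1 hs₀β hw1 hwr hx hn hpen hr1 (by linarith)
      (by linarith) (hcost j) hμ' (hmax' j)
    rw [← hC₁] at this
    linarith
  · subst hw1
    have := estimate_on_interface (i := j) (μ := μ) (ε := ε / 2) (R := R) hU hV hα hα1 hβ1 hs₀β hr hx hn hpen hr1
      (by rw [div_mul_eq_mul_div, div_le_iff₀ hδ]; linarith)
      (by linarith) (fun j s hs => hcost j s 0 hs (by simpa using hR)) (by linarith)
      (fun j' t₁ t₂ z h1 h2 h3 h4 => by linarith [hmax' j' t₁ t₂ z h1 h2 h3 h4]) hC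
    rw [← hC₂] at this
    linarith

/-- Comparison of sub- and supersolutions in coordinates. -/
theorem IsSub.le_of_isSuper [Finite ι] (hU : IsSub D U) (hV : IsSuper D V) (i : ι) (s z : ℝ)
    (hz : 0 ≤ z) : U i s z ≤ V i s z := by
  by_contra! hlt
  have hM := D.one_le_M
  have hlam := D.lam_pos
  obtain ⟨μ, hμ⟩ : ∃ μ, 2 * μ = U i s z - V i s z := ⟨_, mul_div_cancel₀ _ two_ne_zero⟩
  have hμ0 : 0 < μ := by linarith
  obtain ⟨β, hβ0, hβ1, hβμ⟩ : ∃ β > 0, β ≤ 1 ∧ 4 * D.M * β < D.lam * μ := by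
    refine ⟨min 1 (D.lam * μ / (8 * D.M)), by positivity, min_le_left _ _, ?_⟩
    calc 4 * D.M * min 1 (D.lam * μ / (8 * D.M)) ≤ 4 * D.M * (D.lam * μ / (8 * D.M)) := by
          gcongr; exact min_le_right _ _
      _ = D.lam * μ / 2 := by field_simp; norm_num
      _ < D.lam * μ := half_lt_self (by positivity)
  obtain ⟨α, hα, hα1, hαβ, hαμ⟩ : ∃ α > 0, α ≤ 1 ∧ α * (2 * D.M) ≤ β ^ 2 ∧
      α * (s ^ 2 + z ^ 2) ≤ μ := by
    have hpos : 0 < s ^ 2 + z ^ 2 + 1 := by positivity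
    refine ⟨min 1 (min (β ^ 2 / (2 * D.M)) (μ / (s ^ 2 + z ^ 2 + 1))), by positivity,
      min_le_left _ _, ?_, ?_⟩
    · rw [← le_div_iff₀ (by positivity)]
      exact (min_le_right _ _).trans (min_le_left _ _)
    · calc _ ≤ μ / (s ^ 2 + z ^ 2 + 1) * (s ^ 2 + z ^ 2 + 1) :=
            mul_le_mul ((min_le_right _ _).trans (min_le_right _ _)) (by linarith)
              (by positivity) (by positivity)
        _ = μ := div_mul_cancel₀ _ hpos.ne'
  obtain ⟨L, hLs, hLz, hL⟩ : ∃ L, |s| ≤ L ∧ z ≤ L ∧ 2 * D.M < α * L ^ 2 := by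
    have h1 : α * (2 * D.M / α) = 2 * D.M := by field_simp
    have h2 : 0 < 2 * D.M / α := by positivity
    refine ⟨|s| + z + 2 * D.M / α + 1, by linarith, by linarith [abs_nonneg s], ?_⟩
    have h3 : 1 ≤ |s| + z + 2 * D.M / α + 1 := by linarith [abs_nonneg s]
    have h4 : |s| + z + 2 * D.M / α + 1 ≤ (|s| + z + 2 * D.M / α + 1) ^ 2 := by nlinarith only [h3]
    have h5 := mul_le_mul_of_nonneg_left h4 hα.le
    have h6 := mul_nonneg hα.le (add_nonneg (abs_nonneg s) hz)
    linarith
  let _ : TopologicalSpace ι := ⊥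
  have _ : DiscreteTopology ι := ⟨rfl⟩
  have husc : UpperSemicontinuous fun p : ι × ℝ × ℝ => U p.1 p.2.1 p.2.2
      + -V p.1 p.2.1 p.2.2 + -(α * (p.2.1 ^ 2 + p.2.2 ^ 2)) :=
    upperSemicontinuous_prod_of_discrete fun j => ((hU.usc j).add (hV.neg_usc j)).add
      (by fun_prop : Continuous fun p : ℝ × ℝ =>
        -(α * (p.1 ^ 2 + p.2 ^ 2))).upperSemicontinuous
  have hsz : (i, s, z) ∈ (univ : Set ι) ×ˢ Icc (-L) L ×ˢ Icc 0 L :=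
    ⟨mem_univ _, abs_le.1 hLs, hz, hLz⟩
  obtain ⟨⟨j, s₀, z₀⟩, hmem, hm⟩ := (husc.upperSemicontinuousOn _).exists_isMaxOn ⟨_, hsz⟩
    (isCompact_univ.prod (isCompact_Icc.prod isCompact_Icc) :
      IsCompact ((univ : Set ι) ×ˢ Icc (-L) L ×ˢ Icc 0 L))
  have hm0 : U i s z + -V i s z + -(α * (s ^ 2 + z ^ 2)) ≤
    U j s₀ z₀ + -V j s₀ z₀ + -(α * (s₀ ^ 2 + z₀ ^ 2)) := hm hsz
  have hz₀ : 0 ≤ z₀ := hmem.2.2.1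
  have hUV : ∀ j s z, U j s z - V j s z ≤ 2 * D.M := fun j s z => by
    linarith [(abs_le.1 (hU.bounded j s z)).2, (abs_le.1 (hV.bounded j s z)).1]
  have hmax : ∀ j' s' z', 0 ≤ z' → U j' s' z' - V j' s' z' - α * (s' ^ 2 + z' ^ 2) ≤
      U j s₀ z₀ - V j s₀ z₀ - α * (s₀ ^ 2 + z₀ ^ 2) := by
    intro j' s' z' hz'
    by_cases hin : |s'| ≤ L ∧ z' ≤ L
    · have h1 : U j' s' z' + -V j' s' z' + -(α * (s' ^ 2 + z' ^ 2)) ≤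
          U j s₀ z₀ + -V j s₀ z₀ + -(α * (s₀ ^ 2 + z₀ ^ 2)) :=
        hm (⟨mem_univ _, abs_le.1 hin.1, hz', hin.2⟩ :
          (j', s', z') ∈ (univ : Set ι) ×ˢ Icc (-L) L ×ˢ Icc 0 L)
      linarith
    · have hL0 : 0 ≤ L := (abs_nonneg s).trans hLs
      have h1 : L ^ 2 ≤ s' ^ 2 + z' ^ 2 := by
        rcases not_and_or.1 hin with h | h
        · rw [← sq_abs s']
          nlinarith only [not_le.1 h, hL0, sq_nonneg z']
        · nlinarith only [not_le.1 h, hL0, sq_nonneg s']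
      have h2 := mul_le_mul_of_nonneg_left h1 hα.le
      linarith [hUV j' s' z']
  have hval : μ ≤ U j s₀ z₀ - V j s₀ z₀ - α * (s₀ ^ 2 + z₀ ^ 2) := by linarith
  have hnorm : α * (s₀ ^ 2 + z₀ ^ 2) ≤ 2 * D.M := by linarith [hUV j s₀ z₀]
  have hsq := (mul_le_mul_of_nonneg_left hnorm hα.le).trans hαβ
  have hs₀β : α * |s₀| ≤ β := by
    refine le_of_sq_le_sq ?_ hβ0.le
    rw [mul_pow, sq_abs]
    nlinarith only [hsq, sq_nonneg (α * z₀)]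
  have hz₀β : α * z₀ ≤ β := le_of_sq_le_sq (by
    nlinarith only [hsq, sq_nonneg (α * s₀)]) hβ0.le
  rcases hz₀.lt_or_eq with h | h
  · linarith [estimate_interior hU hV h hα hα1 hβ1 hs₀β hz₀β hval (hmax j)]
  · subst h
    simp only [ne_eq, OfNat.ofNat_ne_zero, not_false_eq_true, zero_pow, add_zero] at hval hmax
    linarith [estimate_interface hU hV hα hα1 hβ1 hs₀β hval hmax]

end

/-- The point of the half-plane `ℝ e0 × ℝ₊ ei` with coordinates `(s, max z 0)`. -/
def halfPoint (e0 ei : E3) (s z : ℝ) : E3 := s • e0 + max z 0 • ei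

theorem halfPoint_mem (e0 ei : E3) (s z : ℝ) : halfPoint e0 ei s z ∈ halfPlane e0 ei :=
  ⟨s, max z 0, le_max_right _ _, rfl⟩

theorem halfPoint_mem_junction {N : ℕ} (e0 : E3) (e : Fin N → E3) (i : Fin N) (s z : ℝ) :
    halfPoint e0 (e i) s z ∈ junction N e0 e :=
  mem_iUnion_of_mem i (halfPoint_mem e0 (e i) s z)

theorem exists_halfPoint_of_mem {e0 ei x : E3} (hx : x ∈ halfPlane e0 ei) :
    ∃ s z, 0 ≤ z ∧ x = halfPoint e0 ei s z := by
  obtain ⟨s, z, hz, rfl⟩ := hx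
  exact ⟨s, z, hz, by rw [halfPoint, max_eq_left hz]⟩

theorem halfPoint_zero (e0 ei : E3) (s : ℝ) : halfPoint e0 ei s 0 = s • e0 := by
  simp [halfPoint]

theorem halfPoint_zero_mem_iface (e0 ei : E3) (s : ℝ) : halfPoint e0 ei s 0 ∈ iface e0 :=
  ⟨s, halfPoint_zero e0 ei s⟩

theorem continuous_halfPoint (e0 ei : E3) : Continuous fun p : ℝ × ℝ => halfPoint e0 ei p.1 p.2 := by
  unfold halfPoint
  fun_prop

theorem inner_left_halfPoint {e0 ei : E3} (he0 : ‖e0‖ = 1) (h : ⟪ei, e0⟫ = 0) (s z : ℝ) :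
    ⟪e0, halfPoint e0 ei s z⟫ = s := by
  rw [real_inner_comm] at h
  simp [halfPoint, inner_add_right, inner_smul_right, he0, h]

theorem inner_right_halfPoint {e0 ei : E3} (hei : ‖ei‖ = 1) (h : ⟪ei, e0⟫ = 0) (s z : ℝ) :
    ⟪ei, halfPoint e0 ei s z⟫ = max z 0 := by
  simp [halfPoint, inner_add_right, inner_smul_right, hei, h]

theorem norm_halfPoint_sub_le {e0 ei : E3} (he0 : ‖e0‖ = 1) (hei : ‖ei‖ = 1) (s z s' z' : ℝ) :
    ‖halfPoint e0 ei s z - halfPoint e0 ei s' z'‖ ≤ |s - s'| + |z - z'| := by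
  have h : halfPoint e0 ei s z - halfPoint e0 ei s' z' =
      (s - s') • e0 + (max z 0 - max z' 0) • ei := by
    simp only [halfPoint]; module
  rw [h]
  refine (norm_add_le _ _).trans ?_
  rw [norm_smul, norm_smul, he0, hei, mul_one, mul_one, Real.norm_eq_abs, Real.norm_eq_abs]
  exact add_le_add_right (abs_max_sub_max_le_abs z z' 0) _

theorem isClosed_halfPlane {e0 ei : E3} (he0 : ‖e0‖ = 1) (hei : ‖ei‖ = 1) (h : ⟪ei, e0⟫ = 0) :
    IsClosed (halfPlane e0 ei) := by
  have : halfPlane e0 ei = {x | x = halfPoint e0 ei ⟪e0, x⟫ ⟪ei, x⟫} := by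
    ext x
    constructor
    · intro hx
      obtain ⟨s, z, hz, rfl⟩ := exists_halfPoint_of_mem hx
      rw [mem_ofPred_eq, inner_left_halfPoint he0 h, inner_right_halfPoint hei h, max_eq_left hz]
    · intro hx
      rw [mem_ofPred_eq] at hx
      rw [hx]
      exact halfPoint_mem _ _ _ _
  rw [this]
  exact isClosed_eq continuous_id ((continuous_halfPoint e0 ei).comp
    (by fun_prop : Continuous fun x : E3 => (⟪e0, x⟫, ⟪ei, x⟫)))

theorem halfPoint_notMem_iface {e0 ei : E3} (hei : ‖ei‖ = 1) (h : ⟪ei, e0⟫ = 0) {s z : ℝ}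
    (hz : 0 < z) : halfPoint e0 ei s z ∉ iface e0 := by
  rintro ⟨t, ht⟩
  have h1 := inner_right_halfPoint hei h s z
  rw [ht, inner_smul_right, h, mul_zero, max_eq_left hz.le] at h1
  exact hz.ne h1

section
variable {N : ℕ} {e0 : E3} {e : Fin N → E3} (he0 : ‖e0‖ = 1) (he : ∀ k, ‖e k‖ = 1)
  (horth : ∀ k, ⟪e k, e0⟫ = 0) (heinj : Function.Injective e)
include he0 he horth

theorem halfPoint_coords_eq {i j : Fin N} {s z s' z' : ℝ} (hz : 0 ≤ z) (hz' : 0 ≤ z')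
    (h : halfPoint e0 (e i) s z = halfPoint e0 (e j) s' z') : s = s' ∧ z = z' := by
  have hs : s = s' := by
    rw [← inner_left_halfPoint he0 (horth i) s z, h, inner_left_halfPoint he0 (horth j)]
  subst hs
  rw [halfPoint, halfPoint, add_right_inj, max_eq_left hz, max_eq_left hz'] at h
  have := congrArg norm h
  rw [norm_smul, norm_smul, he, he, mul_one, mul_one, Real.norm_of_nonneg hz,
    Real.norm_of_nonneg hz'] at this
  exact ⟨rfl, this⟩

include heinj

theorem halfPoint_branch_eq {i j : Fin N} {s z s' z' : ℝ} (hz : 0 < z) (hz' : 0 ≤ z')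
    (h : halfPoint e0 (e i) s z = halfPoint e0 (e j) s' z') : i = j := by
  obtain ⟨rfl, rfl⟩ := halfPoint_coords_eq he0 he horth hz.le hz' h
  rw [halfPoint, halfPoint, add_right_inj, max_eq_left hz.le] at h
  exact heinj (smul_right_injective E3 hz.ne' h)

/-- Quadratic polynomials on the branches which agree on the interface form an admissible test
function. -/
theorem exists_testFun (α₁ α₂ : ℝ) (β γ κ : Fin N → ℝ) : ∃ ψ : TestFun N e0 e, ∀ i s z, 0 ≤ z →
    ψ.φ (halfPoint e0 (e i) s z) = α₁ * s + α₂ * s ^ 2 + β i * z + γ i * z ^ 2 + κ i * (s * z) ∧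
    ψ.Dφ i (halfPoint e0 (e i) s z) =
      (α₁ + 2 * α₂ * s + κ i * z) • e0 + (β i + 2 * γ i * z + κ i * s) • e i := by
  classical
  let Q : Fin N → E3 → ℝ := fun i x => α₁ * innerSL ℝ e0 x + α₂ * innerSL ℝ e0 x ^ 2
    + β i * innerSL ℝ (e i) x + γ i * innerSL ℝ (e i) x ^ 2
    + κ i * (innerSL ℝ e0 x * innerSL ℝ (e i) x)
  let G : Fin N → E3 → E3 := fun i x =>
    (α₁ + 2 * α₂ * innerSL ℝ e0 x + κ i * innerSL ℝ (e i) x) • e0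
      + (β i + 2 * γ i * innerSL ℝ (e i) x + κ i * innerSL ℝ e0 x) • e i
  have hQ : ∀ i s z, 0 ≤ z → Q i (halfPoint e0 (e i) s z) =
      α₁ * s + α₂ * s ^ 2 + β i * z + γ i * z ^ 2 + κ i * (s * z) := by
    intro i s z hz
    simp only [Q, innerSL_apply_apply, inner_left_halfPoint he0 (horth i),
      inner_right_halfPoint (he i) (horth i), max_eq_left hz]
  have hQG : ∀ i x, HasFDerivAt (Q i) (innerSL ℝ (G i x)) x := by
    intro i x
    have h0 := (innerSL ℝ e0).hasFDerivAt (x := x)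
    have h1 := (innerSL ℝ (e i)).hasFDerivAt (x := x)
    refine (((((h0.const_mul α₁).add ((h0.pow 2).const_mul α₂)).add (h1.const_mul (β i))).add
      ((h1.pow 2).const_mul (γ i))).add ((h0.mul h1).const_mul (κ i))).congr_fderiv ?_
    ext y
    simp [G]
    ring
  let φ : E3 → ℝ := fun x => if h : ∃ i, x ∈ halfPlane e0 (e i) then Q h.choose x else 0
  have hφ : ∀ i, EqOn φ (Q i) (halfPlane e0 (e i)) := by
    intro i x hx
    have h : ∃ i, x ∈ halfPlane e0 (e i) := ⟨i, hx⟩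
    simp only [φ, dif_pos h]
    obtain ⟨s, z, hz, hxs⟩ := exists_halfPoint_of_mem hx
    obtain ⟨s', z', hz', hxs'⟩ := exists_halfPoint_of_mem h.choose_spec
    obtain ⟨rfl, rfl⟩ := halfPoint_coords_eq he0 he horth hz hz' (hxs.symm.trans hxs')
    rcases hz.lt_or_eq with hz0 | hz0
    · rw [← halfPoint_branch_eq he0 he horth heinj hz0 hz' (hxs.symm.trans hxs')]
    · subst hz0
      calc Q h.choose x = Q h.choose (halfPoint e0 (e h.choose) s 0) := congrArg _ hxs'
        _ = Q i (halfPoint e0 (e i) s 0) := by rw [hQ _ _ _ le_rfl, hQ _ _ _ le_rfl]; ring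
        _ = Q i x := congrArg _ hxs.symm
  refine ⟨⟨φ, G, ?_, ?_, ?_, ?_⟩, fun i s z hz => ⟨?_, ?_⟩⟩
  · exact (locallyFinite_of_finite _).continuousOn_iUnion
      (fun i => isClosed_halfPlane he0 (he i) (horth i))
      fun i => (continuousOn_congr (hφ i)).2
        fun x _ => (hQG i x).continuousAt.continuousWithinAt
  · exact fun i x _ => ⟨_, _, rfl⟩
  · exact fun i x hx => (hQG i x).hasFDerivWithinAt.congr (hφ i) (hφ i hx)
  · intro i
    exact Continuous.continuousOn (by fun_prop)
  · exact (hφ i (halfPoint_mem _ _ _ _)).trans (hQ i s z hz)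
  · simp only [G, innerSL_apply_apply, inner_left_halfPoint he0 (horth i),
      inner_right_halfPoint (he i) (horth i), max_eq_left hz]

omit heinj in
/-- A property holds near a point of the junction once it does so in coordinates on each branch. -/
theorem eventually_junction {P : E3 → Prop} {x : E3}
    (h : ∀ j s z, 0 ≤ z → x = halfPoint e0 (e j) s z → ∃ r > 0, ∀ s' z', |s' - s| < r → 0 ≤ z' →
      |z' - z| < r → P (halfPoint e0 (e j) s' z')) :
    ∀ᶠ y in 𝓝[junction N e0 e] x, P y := by
  rw [junction, nhdsWithin_iUnion, eventually_iSup]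
  intro j
  by_cases hx : x ∈ halfPlane e0 (e j)
  · obtain ⟨s, z, hz, rfl⟩ := exists_halfPoint_of_mem hx
    obtain ⟨r, hr, hP⟩ := h j s z hz rfl
    filter_upwards [self_mem_nhdsWithin, mem_nhdsWithin_of_mem_nhds (ball_mem_nhds _ hr)]
      with y hy hyr
    obtain ⟨s', z', hz', rfl⟩ := exists_halfPoint_of_mem hy
    rw [mem_ball, dist_eq_norm] at hyr
    refine hP s' z' (lt_of_le_of_lt ?_ hyr) hz' (lt_of_le_of_lt ?_ hyr)
    · have := abs_real_inner_le_norm e0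
        (halfPoint e0 (e j) s' z' - halfPoint e0 (e j) s z)
      rwa [inner_sub_right, inner_left_halfPoint he0 (horth j),
        inner_left_halfPoint he0 (horth j), he0, one_mul] at this
    · have := abs_real_inner_le_norm (e j)
        (halfPoint e0 (e j) s' z' - halfPoint e0 (e j) s z)
      rwa [inner_sub_right, inner_right_halfPoint (he j) (horth j),
        inner_right_halfPoint (he j) (horth j), he, one_mul, max_eq_left hz,
        max_eq_left hz'] at this
  · have := (isClosed_halfPlane he0 (he j) (horth j)).isOpen_compl.mem_nhds hx
    filter_upwards [self_mem_nhdsWithin, mem_nhdsWithin_of_mem_nhds this] with y hy hy'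
    exact (hy' hy).elim

end

/-- The control problem on the junction, written in coordinates. -/
theorem exists_dynamics {N : ℕ} {e0 : E3} {e : Fin N → E3} (he0 : ‖e0‖ = 1)
    (he : ∀ k, ‖e k‖ = 1) {A : Type} [MetricSpace A] {Ai : Fin N → Set A}
    (hAcp : ∀ k, IsCompact (Ai k)) {f : Fin N → E3 → A → E3} {Mf Lf : ℝ}
    (hfbdd : ∀ k, ∀ x ∈ halfPlane e0 (e k), ∀ a ∈ Ai k, ‖f k x a‖ ≤ Mf)
    (hflip : ∀ k, ∀ x ∈ halfPlane e0 (e k), ∀ y ∈ halfPlane e0 (e k), ∀ a ∈ Ai k,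
      ‖f k x a - f k y a‖ ≤ Lf * ‖x - y‖)
    {ℓ : Fin N → E3 → A → ℝ} {Mℓ : ℝ}
    (hlcont : ∀ k, ContinuousOn (fun q : E3 × A => ℓ k q.1 q.2)
      ((halfPlane e0 (e k)) ×ˢ (Ai k)))
    (hlbdd : ∀ k, ∀ x ∈ halfPlane e0 (e k), ∀ a ∈ Ai k, |ℓ k x a| ≤ Mℓ)
    (hH2 : ∀ k, ∀ x ∈ halfPlane e0 (e k),
      Convex ℝ {q : E3 × ℝ | ∃ a ∈ Ai k, q = (f k x a, ℓ k x a)})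
    {δ : ℝ} (hδ : 0 < δ)
    (htH3 : ∀ k, ∀ x ∈ iface e0, ∀ s ∈ Icc (-δ) δ, ∃ a ∈ Ai k, ⟪f k x a, e k⟫ = s)
    {lam : ℝ} (hlam : 0 < lam) (m : ℝ) :
    ∃ D : Dynamics (Fin N) A, D.ctrl = Ai ∧ D.lam = lam ∧ m ≤ D.M ∧
      (∀ i s z a, D.b₀ i s z a = ⟪e0, f i (halfPoint e0 (e i) s z) a⟫) ∧
      (∀ i s z a, D.b₁ i s z a = ⟪e i, f i (halfPoint e0 (e i) s z) a⟫) ∧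
      ∀ i s z a, D.cost i s z a = ℓ i (halfPoint e0 (e i) s z) a := by
  have hmem : ∀ i s z, halfPoint e0 (e i) s z ∈ halfPlane e0 (e i) := fun i s z =>
    halfPoint_mem _ _ _ _
  have hf : ∀ i s z, ∀ a ∈ Ai i, ∀ w : E3, ‖w‖ = 1 →
      |⟪w, f i (halfPoint e0 (e i) s z) a⟫| ≤ max (max 1 m) (max Mf Mℓ) := by
    intro i s z a ha w hw
    have h := abs_real_inner_le_norm w (f i (halfPoint e0 (e i) s z) a)
    rw [hw, one_mul] at h
    exact (h.trans (hfbdd i _ (hmem i s z) a ha)).trans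
      ((le_max_left _ _).trans (le_max_right _ _))
  have hlip : ∀ i s z s' z', ∀ a ∈ Ai i, ∀ w : E3, ‖w‖ = 1 →
      |⟪w, f i (halfPoint e0 (e i) s z) a⟫ - ⟪w, f i (halfPoint e0 (e i) s' z') a⟫| ≤
        |Lf| * (|s - s'| + |z - z'|) := by
    intro i s z s' z' a ha w hw
    have h := abs_real_inner_le_norm w
      (f i (halfPoint e0 (e i) s z) a - f i (halfPoint e0 (e i) s' z') a)
    rw [inner_sub_right, hw, one_mul] at h
    refine (h.trans (hflip i _ (hmem i s z) _ (hmem i s' z') a ha)).trans ?_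
    exact mul_le_mul (le_abs_self _) (norm_halfPoint_sub_le he0 (he i) s z s' z')
      (norm_nonneg _) (abs_nonneg _)
  have hctrl : ∀ i s, ∀ t ∈ Icc (-δ) δ, ∃ a ∈ Ai i,
      ⟪e i, f i (halfPoint e0 (e i) s 0) a⟫ = t := by
    intro i s t ht
    obtain ⟨a, ha, hat⟩ := htH3 i _ (halfPoint_zero_mem_iface e0 (e i) s) t ht
    exact ⟨a, ha, by rw [real_inner_comm, hat]⟩
  refine ⟨{
    ctrl := Ai
    b₀ := fun i s z a => ⟪e0, f i (halfPoint e0 (e i) s z) a⟫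
    b₁ := fun i s z a => ⟪e i, f i (halfPoint e0 (e i) s z) a⟫
    cost := fun i s z a => ℓ i (halfPoint e0 (e i) s z) a
    lam := lam
    M := max (max 1 m) (max Mf Mℓ)
    K := |Lf|
    δ := δ
    lam_pos := hlam
    one_le_M := (le_max_left _ _).trans (le_max_left _ _)
    K_nonneg := abs_nonneg _
    δ_pos := hδ
    abs_b₀_le := fun i s z a ha => hf i s z a ha e0 he0
    abs_b₁_le := fun i s z a ha => hf i s z a ha (e i) (he i)
    abs_cost_le := fun i s z a ha =>
      (hlbdd i _ (hmem i s z) a ha).trans ((le_max_right _ _).trans (le_max_right _ _))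
    b₀_lip := fun i s z s' z' a ha => hlip i s z s' z' a ha e0 he0
    b₁_lip := fun i s z s' z' a ha => hlip i s z s' z' a ha (e i) (he i)
    cost_equicont := ?_
    mix := ?_
    inward := fun i s => hctrl i s δ ⟨by linarith, le_rfl⟩
    outward := fun i s => hctrl i s (-δ) ⟨le_rfl, by linarith⟩ }, rfl, rfl,
    (le_max_right _ _).trans (le_max_left _ _), fun _ _ _ _ => rfl, fun _ _ _ _ => rfl,
    fun _ _ _ _ => rfl⟩
  · intro i s z ε hε
    have hc : ContinuousOn
        (Function.uncurry fun (p : ℝ × ℝ) (a : A) => ℓ i (halfPoint e0 (e i) p.1 p.2) a)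
        (univ ×ˢ Ai i) :=
      (hlcont i).comp
        (((continuous_halfPoint e0 (e i)).comp continuous_fst).prodMk continuous_snd).continuousOn
        fun q hq => ⟨hmem i _ _, hq.2⟩
    obtain ⟨w, hw, hwε⟩ := (hAcp i).mem_uniformity_of_prod hc (mem_univ (s, z))
      (dist_mem_uniformity hε)
    rw [nhdsWithin_univ] at hw
    obtain ⟨r, hr, hrw⟩ := Metric.mem_nhds_iff.1 hw
    refine ⟨r, hr, fun s' z' hs' hz' a ha => ?_⟩
    have hp : (s', z') ∈ w := hrw (by
      rw [mem_ball, Prod.dist_eq]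
      exact max_lt hs' hz')
    exact hwε _ hp a ha
  · intro i s a ha a' ha' τ hτ hτ1
    obtain ⟨a'', ha'', h⟩ := hH2 i _ (hmem i s 0) ⟨a, ha, rfl⟩ ⟨a', ha', rfl⟩
      (sub_nonneg.2 hτ1) hτ (sub_add_cancel 1 τ)
    rw [Prod.smul_mk, Prod.smul_mk, Prod.mk_add_mk, Prod.mk.injEq] at h
    refine ⟨a'', ha'', ?_, ?_, ?_⟩
    · rw [← h.1, inner_add_right, inner_smul_right, inner_smul_right]
    · rw [← h.1, inner_add_right, inner_smul_right, inner_smul_right]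
    · rw [← h.2, smul_eq_mul, smul_eq_mul]

section
variable {N : ℕ} {e0 : E3} {e : Fin N → E3} {A : Type} [MetricSpace A]
  {f : Fin N → E3 → A → E3} {ℓ : Fin N → E3 → A → ℝ} {D : Dynamics (Fin N) A}
  (he0 : ‖e0‖ = 1) (he : ∀ k, ‖e k‖ = 1) (horth : ∀ k, ⟪e k, e0⟫ = 0)
  (heinj : Function.Injective e)
  (hb₀ : ∀ i s z a, D.b₀ i s z a = ⟪e0, f i (halfPoint e0 (e i) s z) a⟫)
  (hb₁ : ∀ i s z a, D.b₁ i s z a = ⟪e i, f i (halfPoint e0 (e i) s z) a⟫)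
  (hcost : ∀ i s z a, D.cost i s z a = ℓ i (halfPoint e0 (e i) s z) a)
include he0 he horth heinj hb₀ hb₁ hcost

/-- A subsolution on the junction is a subsolution in coordinates. -/
theorem isSub_halfPoint {u : E3 → ℝ} (husc : UpperSemicontinuousOn u (junction N e0 e))
    (hMu : ∀ x ∈ junction N e0 e, |u x| ≤ D.M)
    (hu : IsSubSol N e0 e D.ctrl f ℓ D.lam u) :
    IsSub D fun i s z => u (halfPoint e0 (e i) s z) where
  usc i p := by
    intro c hc
    have h := husc _ (halfPoint_mem_junction e0 e i p.1 p.2) c hc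
    exact (tendsto_nhdsWithin_iff.2 ⟨(continuous_halfPoint e0 (e i)).tendsto p,
      .of_forall fun q => halfPoint_mem_junction e0 e i q.1 q.2⟩).eventually h
  bounded i s z := hMu _ (halfPoint_mem_junction e0 e i s z)
  trace i j s := by simp only [halfPoint_zero]
  interior i s z hz p q A B C hloc a ha := by
    obtain ⟨r, hr, hloc⟩ := hloc
    obtain ⟨ψ, hψ⟩ := exists_testFun he0 he horth heinj (p - 2 * A * s - C * z) A
      (fun _ => q - 2 * B * z - C * s) (fun _ => B) (fun _ => C)
    have hmax : IsLocalMaxOn (fun y => u y - ψ.φ y) (junction N e0 e)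
        (halfPoint e0 (e i) s z) := by
      refine eventually_junction he0 he horth fun j s₁ z₁ hz₁ h => ?_
      obtain rfl := halfPoint_branch_eq he0 he horth heinj hz hz₁ h
      obtain ⟨rfl, rfl⟩ := halfPoint_coords_eq he0 he horth hz.le hz₁ h
      refine ⟨r, hr, fun s' z' hs' hz' hzr => ?_⟩
      beta_reduce
      rw [(hψ i s z hz.le).1, (hψ i s' z' hz').1]
      linarith [hloc s' z' hs' hzr]
    have := hu _ (halfPoint_mem_junction e0 e i s z) ψ hmax i (halfPoint_mem _ _ _ _) a ha
      (.inl (halfPoint_notMem_iface (he i) (horth i) hz))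
    rw [(hψ i s z hz.le).2, inner_add_left, real_inner_smul_left, real_inner_smul_left,
      ← hb₀, ← hb₁, ← hcost] at this
    linarith
  interface s p A q B C hloc i a ha hin := by
    obtain ⟨ψ, hψ⟩ := exists_testFun he0 he horth heinj (p - 2 * A * s) A
      (fun j => q j - C j * s) B C
    have hmax : IsLocalMaxOn (fun y => u y - ψ.φ y) (junction N e0 e)
        (halfPoint e0 (e i) s 0) := by
      refine eventually_junction he0 he horth fun j s₁ z₁ hz₁ h => ?_
      obtain ⟨rfl, rfl⟩ := halfPoint_coords_eq he0 he horth le_rfl hz₁ h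
      obtain ⟨r, hr, hloc⟩ := hloc j
      refine ⟨r, hr, fun s' z' hs' hz' hzr => ?_⟩
      rw [sub_zero, abs_of_nonneg hz'] at hzr
      beta_reduce
      rw [h, (hψ j s 0 le_rfl).1, (hψ j s' z' hz').1]
      linarith [hloc s' z' hs' hz' hzr]
    rw [hb₁, real_inner_comm] at hin
    have := hu _ (halfPoint_mem_junction e0 e i s 0) ψ hmax i (halfPoint_mem _ _ _ _) a ha
      (.inr hin)
    rw [(hψ i s 0 le_rfl).2, inner_add_left, real_inner_smul_left, real_inner_smul_left,
      ← hb₀, ← hb₁, ← hcost] at this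
    linarith

/-- A supersolution on the junction is a supersolution in coordinates. -/
theorem isSuper_halfPoint {v : E3 → ℝ} (hlsc : LowerSemicontinuousOn v (junction N e0 e))
    (hMv : ∀ x ∈ junction N e0 e, |v x| ≤ D.M)
    (hv : IsSuperSol N e0 e D.ctrl f ℓ D.lam v) [NeZero N] :
    IsSuper D fun i s z => v (halfPoint e0 (e i) s z) where
  lsc i p := by
    intro c hc
    have h := hlsc _ (halfPoint_mem_junction e0 e i p.1 p.2) c hc
    exact (tendsto_nhdsWithin_iff.2 ⟨(continuous_halfPoint e0 (e i)).tendsto p,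
      .of_forall fun q => halfPoint_mem_junction e0 e i q.1 q.2⟩).eventually h
  bounded i s z := hMv _ (halfPoint_mem_junction e0 e i s z)
  trace i j s := by simp only [halfPoint_zero]
  interior i s z hz p q A B hloc := by
    obtain ⟨r, hr, hloc⟩ := hloc
    obtain ⟨ψ, hψ⟩ := exists_testFun he0 he horth heinj (p - 2 * A * s) A
      (fun _ => q - 2 * B * z) (fun _ => B) (fun _ => 0)
    have hmin : IsLocalMinOn (fun y => v y - ψ.φ y) (junction N e0 e)
        (halfPoint e0 (e i) s z) := by
      refine eventually_junction he0 he horth fun j s₁ z₁ hz₁ h => ?_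
      obtain rfl := halfPoint_branch_eq he0 he horth heinj hz hz₁ h
      obtain ⟨rfl, rfl⟩ := halfPoint_coords_eq he0 he horth hz.le hz₁ h
      refine ⟨r, hr, fun s' z' hs' hz' hzr => ?_⟩
      beta_reduce
      rw [(hψ i s z hz.le).1, (hψ i s' z' hz').1]
      linarith [hloc s' z' hs' hzr]
    obtain ⟨j, hj, a, ha, -, h⟩ := hv _ (halfPoint_mem_junction e0 e i s z) ψ hmin
    obtain ⟨s₁, z₁, hz₁, hx⟩ := exists_halfPoint_of_mem hj
    obtain rfl := halfPoint_branch_eq he0 he horth heinj hz hz₁ hx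
    refine ⟨a, ha, ?_⟩
    rw [(hψ i s z hz.le).2, inner_add_left, real_inner_smul_left, real_inner_smul_left,
      ← hb₀, ← hb₁, ← hcost] at h
    linarith
  interface s p A q B hloc := by
    obtain ⟨ψ, hψ⟩ := exists_testFun he0 he horth heinj (p - 2 * A * s) A q B (fun _ => 0)
    have hmin : IsLocalMinOn (fun y => v y - ψ.φ y) (junction N e0 e)
        (halfPoint e0 (e 0) s 0) := by
      refine eventually_junction he0 he horth fun j s₁ z₁ hz₁ h => ?_
      obtain ⟨rfl, rfl⟩ := halfPoint_coords_eq he0 he horth le_rfl hz₁ h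
      obtain ⟨r, hr, hloc⟩ := hloc j
      refine ⟨r, hr, fun s' z' hs' hz' hzr => ?_⟩
      rw [sub_zero, abs_of_nonneg hz'] at hzr
      beta_reduce
      rw [h, (hψ j s 0 le_rfl).1, (hψ j s' z' hz').1]
      linarith [hloc s' z' hs' hz' hzr]
    obtain ⟨j, -, a, ha, hin, h⟩ := hv _ (halfPoint_mem_junction e0 e 0 s 0) ψ hmin
    have hx : halfPoint e0 (e 0) s 0 = halfPoint e0 (e j) s 0 := by simp only [halfPoint_zero]
    rw [hx] at h hin
    have hin := hin.resolve_left (not_not.2 (halfPoint_zero_mem_iface e0 (e j) s))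
    rw [real_inner_comm, ← hb₁] at hin
    refine ⟨j, a, ha, hin, ?_⟩
    rw [(hψ j s 0 le_rfl).2, inner_add_left, real_inner_smul_left, real_inner_smul_left,
      ← hb₀, ← hb₁, ← hcost] at h
    linarith

end

end JunctionHJ

/-- Global comparison principle under normal controllability: a bounded usc
subsolution is below any bounded lsc supersolution. -/
theorem stmt_19
    (N : ℕ) (hN : 2 ≤ N) (e0 : E3) (e : Fin N → E3)
    (he0 : ‖e0‖ = 1) (he : ∀ k, ‖e k‖ = 1)
    (heinj : Function.Injective e) (hee0 : ∀ k, e k ≠ e0)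
    (horth : ∀ k, ⟪e k, e0⟫ = 0)
    {A : Type} [MetricSpace A] (Ai : Fin N → Set A)
    (hAne : ∀ k, (Ai k).Nonempty) (hAcp : ∀ k, IsCompact (Ai k))
    (hAdisj : ∀ k l, k ≠ l → Disjoint (Ai k) (Ai l))
    (f : Fin N → E3 → A → E3) (Mf Lf : ℝ)
    (hfcont : ∀ k, ContinuousOn (fun q : E3 × A => f k q.1 q.2)
      ((halfPlane e0 (e k)) ×ˢ (Ai k)))
    (hfplane : ∀ k, ∀ x ∈ halfPlane e0 (e k), ∀ a ∈ Ai k,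
      ∃ c0 ci : ℝ, f k x a = c0 • e0 + ci • e k)
    (hfbdd : ∀ k, ∀ x ∈ halfPlane e0 (e k), ∀ a ∈ Ai k, ‖f k x a‖ ≤ Mf)
    (hflip : ∀ k, ∀ x ∈ halfPlane e0 (e k), ∀ y ∈ halfPlane e0 (e k), ∀ a ∈ Ai k,
      ‖f k x a - f k y a‖ ≤ Lf * ‖x - y‖)
    (ℓ : Fin N → E3 → A → ℝ) (Mℓ : ℝ) (ω : ℝ → ℝ)
    (hωmono : Monotone ω) (hω0 : ω 0 = 0)
    (hlcont : ∀ k, ContinuousOn (fun q : E3 × A => ℓ k q.1 q.2)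
      ((halfPlane e0 (e k)) ×ˢ (Ai k)))
    (hlbdd : ∀ k, ∀ x ∈ halfPlane e0 (e k), ∀ a ∈ Ai k, |ℓ k x a| ≤ Mℓ)
    (hlmod : ∀ k, ∀ x ∈ halfPlane e0 (e k), ∀ y ∈ halfPlane e0 (e k), ∀ a ∈ Ai k,
      |ℓ k x a - ℓ k y a| ≤ ω ‖x - y‖)
    (hH2 : ∀ k, ∀ x ∈ halfPlane e0 (e k),
      Convex ℝ {q : E3 × ℝ | ∃ a ∈ Ai k, q = (f k x a, ℓ k x a)})
    (δ : ℝ) (hδ : 0 < δ)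
    (htH3 : ∀ k, ∀ x ∈ iface e0, ∀ s ∈ Icc (-δ) δ,
      ∃ a ∈ Ai k, ⟪f k x a, e k⟫ = s)
    (lam : ℝ) (hlam : 0 < lam)
    (u : E3 → ℝ) (husc : UpperSemicontinuousOn u (junction N e0 e))
    (Mu : ℝ) (hMu : ∀ x ∈ junction N e0 e, |u x| ≤ Mu)
    (hu : IsSubSol N e0 e Ai f ℓ lam u)
    (v : E3 → ℝ) (hvlsc : LowerSemicontinuousOn v (junction N e0 e))
    (Mv : ℝ) (hMv : ∀ x ∈ junction N e0 e, |v x| ≤ Mv)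
    (hv : IsSuperSol N e0 e Ai f ℓ lam v) :
    ∀ x ∈ junction N e0 e, u x ≤ v x := by
  obtain ⟨D, rfl, rfl, hM, hb₀, hb₁, hcost⟩ := JunctionHJ.exists_dynamics he0 he hAcp hfbdd hflip
    hlcont hlbdd hH2 hδ htH3 hlam (max Mu Mv)
  have : NeZero N := ⟨by omega⟩
  have hU := JunctionHJ.isSub_halfPoint he0 he horth heinj hb₀ hb₁ hcost husc
    (fun x hx => (hMu x hx).trans ((le_max_left _ _).trans hM)) hu
  have hV := JunctionHJ.isSuper_halfPoint he0 he horth heinj hb₀ hb₁ hcost hvlsc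
    (fun x hx => (hMv x hx).trans ((le_max_right _ _).trans hM)) hv
  intro x hx
  obtain ⟨i, hi⟩ := mem_iUnion.1 hx
  obtain ⟨s, z, hz, rfl⟩ := JunctionHJ.exists_halfPoint_of_mem hi
  exact hU.le_of_isSuper hV i s z hz
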